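/- Let G be a finitely presented group and let N be a normal subgroup of G with G' ≤ N. Then the subgroup H = {(g₁,g₂) ∈ G × G : g₁g₂ ∈ N} of G × G (the N-fibre product twisted by the inversion automorphism of the abelian group G/N) is finitely presented if and only if N is finitely generated. -/

import Mathlib

/-- A group is finitely presented if it is the quotient of a finitely generated free group
by the normal closure of finitely many relators. -/
def FinitelyPresentedGroup (G : Type*) [Group G] : Prop :=
  ∃ (n : ℕ) (f : FreeGroup (Fin n) →* G) (S : Finset (FreeGroup (Fin n))),
    Function.Surjective f ∧ f.ker = Subgroup.normalClosure (S : Set (FreeGroup (Fin n)))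


theorem fp_ker {A B : Type*} [Group A] [Group B] [hA : Group.FG A]
    [hB : Group.IsFinitelyPresented B] (f : A →* B) (hf : Function.Surjective f) :
    f.ker.IsFinitelyNormallyGenerated := by
  obtain ⟨n, φ, hφ, S, hS, hSk⟩ := hB.out
  obtain ⟨T, hT, hTf⟩ := Group.fg_iff.1 hA
  let l : FreeGroup (Fin n) →* A := FreeGroup.lift (fun i => Function.surjInv hf (φ (FreeGroup.of i)))
  have hl : f.comp l = φ := by
    ext i
    simp [l, Function.surjInv_eq hf]
  have hl' : ∀ w, f (l w) = φ w := fun w => DFunLike.congr_fun hl w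
  choose w hw using fun a : A => hφ (f a)
  let Y : Set A := l '' S ∪ (fun a => a⁻¹ * (l (w a))) '' T
  have hYk : Subgroup.normalClosure Y ≤ f.ker := by
    apply Subgroup.normalClosure_le_normal
    rintro _ (⟨s, hs, rfl⟩ | ⟨a, ha, rfl⟩)
    · have : s ∈ φ.ker := hSk ▸ Subgroup.subset_normalClosure hs
      simpa [MonoidHom.mem_ker, hl'] using this
    · simp [MonoidHom.mem_ker, hl', hw]
  refine ⟨Y, (hS.image _).union (hTf.image _), le_antisymm hYk ?_⟩
  intro a ha
  let q := QuotientGroup.mk' (Subgroup.normalClosure Y)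
  have hr : ∀ a, q a ∈ (q.comp l).range := by
    intro a
    have : Subgroup.closure T ≤ (q.comp l).range.comap q := by
      rw [Subgroup.closure_le]
      intro a ha
      refine ⟨w a, ?_⟩
      refine ((QuotientGroup.eq (s := Subgroup.normalClosure Y)).2 ?_).symm
      exact Subgroup.subset_normalClosure (Or.inr ⟨a, ha, rfl⟩)
    rw [hT] at this
    exact this (Subgroup.mem_top a)
  obtain ⟨v, hv⟩ := hr a
  have h1 : (l v)⁻¹ * a ∈ Subgroup.normalClosure Y := QuotientGroup.eq.1 hv
  have h2 : v ∈ φ.ker := by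
    have := hYk h1
    rw [MonoidHom.mem_ker] at this ha ⊢
    simpa [hl', ha] using this
  have h3 : φ.ker ≤ (Subgroup.normalClosure Y).comap l := by
    rw [← hSk]
    apply Subgroup.normalClosure_le_normal
    intro s hs
    exact Subgroup.subset_normalClosure (Or.inl ⟨s, hs, rfl⟩)
  have h4 := (Subgroup.normalClosure Y).mul_mem (h3 h2) h1
  simpa using h4

theorem fp_fg {A : Type*} [Group A] [hA : Group.IsFinitelyPresented A] : Group.FG A := by
  obtain ⟨n, φ, hφ, -⟩ := hA.out
  exact Group.fg_of_surjective hφ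

theorem fp_of_free {A : Type*} [Group A] [IsFreeGroup A] [hA : Group.FG A] :
    Group.IsFinitelyPresented A := by
  obtain ⟨n, φ, hφ⟩ : ∃ (n : ℕ) (φ : FreeGroup (Fin n) →* A), Function.Surjective φ := by
    obtain ⟨T, hT⟩ := Group.fg_def.1 hA
    refine ⟨T.card, FreeGroup.lift (fun i => (T.equivFin.symm i : A)), ?_⟩
    rw [← MonoidHom.range_eq_top, FreeGroup.range_lift_eq_closure, ← hT]
    congr 1
    ext x
    constructor
    · rintro ⟨i, rfl⟩; simp
    · intro hx; exact ⟨T.equivFin ⟨x, hx⟩, by simp⟩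
  let σ : A →* FreeGroup (Fin n) := IsFreeGroup.lift (fun i => Function.surjInv hφ (IsFreeGroup.of i))
  have hσ : ∀ a, φ (σ a) = a := by
    have : φ.comp σ = MonoidHom.id A := by
      apply IsFreeGroup.ext_hom
      intro i
      simp [σ, Function.surjInv_eq hφ]
    intro a
    exact DFunLike.congr_fun this a
  let Y : Set (FreeGroup (Fin n)) := Set.range (fun i => (FreeGroup.of i)⁻¹ * σ (φ (FreeGroup.of i)))
  refine ⟨n, φ, hφ, Y, Set.finite_range _, le_antisymm ?_ ?_⟩
  · apply Subgroup.normalClosure_le_normal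
    rintro _ ⟨i, rfl⟩
    simp [MonoidHom.mem_ker, hσ]
  · intro x hx
    let q := QuotientGroup.mk' (Subgroup.normalClosure Y)
    have : q = q.comp (σ.comp φ) := by
      ext i
      exact QuotientGroup.eq.2 (Subgroup.subset_normalClosure ⟨i, rfl⟩)
    have h2 : q x = 1 := by
      rw [this]
      simp [(MonoidHom.mem_ker).1 hx]
    exact (QuotientGroup.eq_one_iff x).1 h2

theorem fp_of_finiteIndex {A : Type*} [Group A] [hA : Group.IsFinitelyPresented A]
    (K : Subgroup A) [hK : K.FiniteIndex] : Group.IsFinitelyPresented K := by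
  obtain ⟨n, φ, hφ, S, hS, hSk⟩ := hA.out
  let E : Subgroup (FreeGroup (Fin n)) := K.comap φ
  have : E.FiniteIndex := ⟨by rw [Subgroup.index_comap_of_surjective K hφ]; exact hK.1⟩
  have : Group.IsFinitelyPresented E := fp_of_free
  let ψ : E →* K := φ.subgroupComap K
  have hψ : Function.Surjective ψ := MonoidHom.subgroupComap_surjective_of_surjective φ K hφ
  apply Group.IsFinitelyPresented.of_surjective ψ hψ
  -- transversal
  obtain ⟨C, hC, -⟩ := E.exists_isComplement_right 1
  have hCf : C.Finite := hC.finite_right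
  have hSE : ∀ s ∈ S, ∀ c, c * s * c⁻¹ ∈ φ.ker := by
    intro s hs c
    have : s ∈ φ.ker := hSk ▸ Subgroup.subset_normalClosure hs
    exact (MonoidHom.normal_ker φ).conj_mem s this c
  have hkE : φ.ker ≤ E := fun x hx => by
    change φ x ∈ K
    rw [MonoidHom.mem_ker.1 hx]; exact K.one_mem
  let Y : Set E := {y | (y : FreeGroup (Fin n)) ∈ Set.image2 (fun c s => c * s * c⁻¹) C S}
  have hY : Y.Finite := (hCf.image2 _ hS).preimage Subtype.val_injective.injOn
  refine ⟨Y, hY, le_antisymm ?_ ?_⟩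
  · apply Subgroup.normalClosure_le_normal
    rintro ⟨y, hy⟩ ⟨c, hc, s, hs, rfl⟩
    rw [SetLike.mem_coe, MonoidHom.mem_ker]
    apply Subtype.ext
    exact MonoidHom.mem_ker.1 (hSE s hs c)
  · have key : φ.ker ≤ (Subgroup.normalClosure Y).map E.subtype := by
      rw [← hSk, Subgroup.normalClosure, Subgroup.closure_le]
      intro x hx
      obtain ⟨s, hs, hx⟩ := Group.mem_conjugatesOfSet_iff.1 hx
      obtain ⟨g, rfl⟩ := isConj_iff.1 hx
      obtain ⟨⟨e, c⟩, hec⟩ := hC.surjective g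
      have hy : (⟨c * s * (c : FreeGroup (Fin n))⁻¹, hkE (hSE s hs c)⟩ : E) ∈ Y :=
        ⟨c, c.2, s, hs, rfl⟩
      refine ⟨(⟨e, e.2⟩ : E) * ⟨_, hkE (hSE s hs c)⟩ * (⟨e, e.2⟩ : E)⁻¹,
        Subgroup.normalClosure_normal.conj_mem _ (Subgroup.subset_normalClosure hy) _, ?_⟩
      simp only at hec
      rw [← hec]
      simp [mul_assoc]
    rintro ⟨x, hx⟩ hxk
    have : x ∈ φ.ker := by
      have := congrArg Subtype.val (MonoidHom.mem_ker.1 hxk)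
      exact this
    obtain ⟨y, hy, hyx⟩ := key this
    have : y = ⟨x, hx⟩ := Subtype.ext hyx
    exact this ▸ hy

theorem fp_prod {A B : Type*} [Group A] [Group B] [hA : Group.IsFinitelyPresented A]
    [hB : Group.IsFinitelyPresented B] : Group.IsFinitelyPresented (A × B) := by
  have : Group.FG A := fp_fg
  have : Group.FG B := fp_fg
  obtain ⟨S, hS, hSf⟩ := Group.fg_iff.1 (inferInstance : Group.FG A)
  obtain ⟨T, hT, hTf⟩ := Group.fg_iff.1 (inferInstance : Group.FG B)
  apply Group.IsFinitelyPresented.of_surjective (Monoid.Coprod.toProd (M := A) (N := B))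
    Monoid.Coprod.toProd_surjective
  let Y : Set (Monoid.Coprod A B) :=
    Set.image2 (fun a b => (Monoid.Coprod.inl a * Monoid.Coprod.inr b)⁻¹ * (Monoid.Coprod.inr b * Monoid.Coprod.inl a)) S T
  refine ⟨Y, hSf.image2 _ hTf, le_antisymm ?_ ?_⟩
  · apply Subgroup.normalClosure_le_normal
    rintro _ ⟨a, ha, b, hb, rfl⟩
    simp [MonoidHom.mem_ker]
  · let q := QuotientGroup.mk' (Subgroup.normalClosure Y)
    have h1 : ∀ a ∈ S, ∀ b ∈ T, Commute (q (Monoid.Coprod.inl a)) (q (Monoid.Coprod.inr b)) := by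
      intro a ha b hb
      have := QuotientGroup.eq.2 (Subgroup.subset_normalClosure (show _ ∈ Y from ⟨a, ha, b, hb, rfl⟩))
      exact this
    have h2 : ∀ a ∈ S, ∀ b, Commute (q (Monoid.Coprod.inl a)) (q (Monoid.Coprod.inr b)) := by
      intro a ha b
      have : Subgroup.closure T ≤ (Subgroup.centralizer {q (Monoid.Coprod.inl a)}).comap (q.comp Monoid.Coprod.inr) := by
        rw [Subgroup.closure_le]
        intro b hb
        simp only [SetLike.mem_coe, Subgroup.mem_comap, Subgroup.mem_centralizer_singleton_iff]
        exact (h1 a ha b hb).eq.symm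
      rw [hT] at this
      exact (Subgroup.mem_centralizer_singleton_iff.1 (this (Subgroup.mem_top b))).symm
    have h3 : ∀ a b, Commute (q (Monoid.Coprod.inl a)) (q (Monoid.Coprod.inr b)) := by
      intro a b
      have : Subgroup.closure S ≤ (Subgroup.centralizer {q (Monoid.Coprod.inr b)}).comap (q.comp Monoid.Coprod.inl) := by
        rw [Subgroup.closure_le]
        intro a ha
        simp only [SetLike.mem_coe, Subgroup.mem_comap, Subgroup.mem_centralizer_singleton_iff]
        exact (h2 a ha b).eq
      rw [hS] at this
      exact (Subgroup.mem_centralizer_singleton_iff.1 (this (Subgroup.mem_top a)))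
    let g : A × B →* _ := MonoidHom.noncommCoprod (q.comp Monoid.Coprod.inl) (q.comp Monoid.Coprod.inr) h3
    have hg : g.comp Monoid.Coprod.toProd = q := by
      apply Monoid.Coprod.hom_ext
      · ext a; simp [g]
      · ext a; simp [g]
    intro x hx
    have : q x = 1 := by
      rw [← hg, MonoidHom.comp_apply, MonoidHom.mem_ker.1 hx, map_one]
    exact (QuotientGroup.eq_one_iff x).1 this

theorem closure_normal_of_gens {A : Type*} [Group A] (X T : Set A) (hX : Subgroup.closure X = ⊤)
    (h1 : ∀ x ∈ X, ∀ t ∈ T, x * t * x⁻¹ ∈ Subgroup.closure T)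
    (h2 : ∀ x ∈ X, ∀ t ∈ T, x⁻¹ * t * x ∈ Subgroup.closure T) :
    (Subgroup.closure T).Normal := by
  have e1 : ∀ x ∈ X, ∀ w ∈ Subgroup.closure T, x * w * x⁻¹ ∈ Subgroup.closure T := by
    intro x hx
    have : Subgroup.closure T ≤ (Subgroup.closure T).comap (MulAut.conj x).toMonoidHom := by
      rw [Subgroup.closure_le]
      intro t ht
      exact h1 x hx t ht
    intro w hw
    exact this hw
  have e2 : ∀ x ∈ X, ∀ w ∈ Subgroup.closure T, x⁻¹ * w * x ∈ Subgroup.closure T := by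
    intro x hx
    have : Subgroup.closure T ≤ (Subgroup.closure T).comap (MulAut.conj x⁻¹).toMonoidHom := by
      rw [Subgroup.closure_le]
      intro t ht
      simpa using h2 x hx t ht
    intro w hw
    simpa using this hw
  refine ⟨fun w hw g => ?_⟩
  have hg : g ∈ Subgroup.closure X := hX ▸ Subgroup.mem_top g
  induction hg using Subgroup.closure_induction'' generalizing w with
  | mem x hx => exact e1 x hx w hw
  | inv_mem x hx => simpa using e2 x hx w hw
  | one => simpa using hw
  | mul x y _ _ hx hy =>
    have := hx _ (hy w hw)
    simpa [mul_assoc] using this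

/-- An endomorphism of a group descending to an automorphism of the quotient. -/
theorem exists_quot_aut {F : Type*} [Group F] (Φ Ψ : F →* F) (L : Subgroup F) [L.Normal]
    (hΦ : L ≤ L.comap Φ) (hΨ : L ≤ L.comap Ψ)
    (X : Set F) (hX : Subgroup.closure X = ⊤)
    (h1 : ∀ x ∈ X, x⁻¹ * Φ (Ψ x) ∈ L) (h2 : ∀ x ∈ X, x⁻¹ * Ψ (Φ x) ∈ L) :
    ∃ φ : MulAut (F ⧸ L), ∀ w : F, φ (QuotientGroup.mk' L w) = QuotientGroup.mk' L (Φ w) := by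
  let a := QuotientGroup.map L L Φ hΦ
  let b := QuotientGroup.map L L Ψ hΨ
  have hab : b.comp a = MonoidHom.id _ := by
    apply QuotientGroup.monoidHom_ext
    apply MonoidHom.eq_of_eqOn_dense hX
    intro x hx
    exact (QuotientGroup.eq.2 (h2 x hx)).symm
  have hba : a.comp b = MonoidHom.id _ := by
    apply QuotientGroup.monoidHom_ext
    apply MonoidHom.eq_of_eqOn_dense hX
    intro x hx
    exact (QuotientGroup.eq.2 (h1 x hx)).symm
  exact ⟨MonoidHom.toMulEquiv a b hab hba, fun w => rfl⟩

theorem semidirect_fg {A C : Type*} [Group A] [Group C] [hA : Group.FG A] [hC : Group.FG C]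
    (φ : C →* MulAut A) : Group.FG (A ⋊[φ] C) := by
  obtain ⟨S, hS, hSf⟩ := Group.fg_iff.1 hA
  obtain ⟨T, hT, hTf⟩ := Group.fg_iff.1 hC
  refine Group.fg_iff.2 ⟨SemidirectProduct.inl '' S ∪ SemidirectProduct.inr '' T, ?_,
    (hSf.image _).union (hTf.image _)⟩
  rw [Subgroup.closure_union, ← MonoidHom.map_closure, ← MonoidHom.map_closure, hS, hT]
  rw [eq_top_iff]
  intro x _
  rw [← SemidirectProduct.inl_left_mul_inr_right x]
  exact Subgroup.mul_mem_sup ⟨_, Subgroup.mem_top _, rfl⟩ ⟨_, Subgroup.mem_top _, rfl⟩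

theorem zpowers_comm {A B : Type*} [Group A] [Group B] (α : MulAut A) (β : MulAut B) (f : A →* B)
    (h : ∀ a, f (α a) = β (f a)) (g : Multiplicative ℤ) :
    f.comp (MulEquiv.toMonoidHom ((zpowersHom (MulAut A) α) g)) =
      (MulEquiv.toMonoidHom ((zpowersHom (MulAut B) β) ((MonoidHom.id _) g))).comp f := by
  ext a
  simp only [zpowersHom_apply, MonoidHom.comp_apply, MulEquiv.toMonoidHom_eq_coe,
    MonoidHom.coe_coe, MonoidHom.id_apply]
  have hn : ∀ (n : ℕ) (a : A), f ((α ^ n) a) = (β ^ n) (f a) := by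
    intro n
    induction n with
    | zero => intro a; simp
    | succ n ih => intro a; rw [pow_succ, pow_succ, MulAut.mul_apply, MulAut.mul_apply, ih, h]
  obtain ⟨n, hz⟩ := Int.eq_nat_or_neg (Multiplicative.toAdd g)
  rcases hz with hz | hz <;> rw [hz]
  · simp only [zpow_natCast, hn]
  · simp only [zpow_neg, zpow_natCast]
    rw [MulAut.inv_apply, MulAut.inv_apply, MulEquiv.eq_symm_apply, ← hn, MulEquiv.apply_symm_apply]

/-- Relators of the base of a finitely presented cyclic extension. -/
theorem zstep_rel {K F : Type*} [Group K] [Group F] [Group.FG F] (φ : MulAut K)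
    (hΓ : Group.IsFinitelyPresented (K ⋊[zpowersHom (MulAut K) φ] Multiplicative ℤ))
    (p : F →* K) (hp : Function.Surjective p) (Φ Ψ : F →* F)
    (hΦ : ∀ w, p (Φ w) = φ (p w)) (hΨ : ∀ w, p (Ψ w) = φ⁻¹ (p w)) :
    ∃ R : Set F, R.Finite ∧ R ⊆ p.ker ∧ ∀ L : Subgroup F, L.Normal → R ⊆ L → L ≤ L.comap Φ →
      L ≤ L.comap Ψ → p.ker ≤ L := by
  obtain ⟨X, hX, hXf⟩ := Group.fg_iff.1 (inferInstance : Group.FG F)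
  let R1 : Set F := (fun x => x⁻¹ * Φ (Ψ x)) '' X ∪ (fun x => x⁻¹ * Ψ (Φ x)) '' X
  have hR1 : R1 ⊆ p.ker := by
    rintro _ (⟨x, -, rfl⟩ | ⟨x, -, rfl⟩) <;> simp [MonoidHom.mem_ker, hΦ, hΨ]
  let C : Set (Subgroup F) := {L | L.Normal ∧ R1 ⊆ L ∧ L ≤ L.comap Φ ∧ L ≤ L.comap Ψ}
  let L0 : Subgroup F := sInf C
  have hn0 : L0.Normal := ⟨fun n hn g => by
    rw [Subgroup.mem_sInf] at hn ⊢
    intro L hL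
    exact hL.1.conj_mem n (hn L hL) g⟩
  have hR0 : R1 ⊆ L0 := fun x hx => by
    rw [SetLike.mem_coe, Subgroup.mem_sInf]
    intro L hL
    exact hL.2.1 hx
  have hΦ0 : L0 ≤ L0.comap Φ := fun x hx => by
    rw [Subgroup.mem_comap, Subgroup.mem_sInf]
    intro L hL
    exact hL.2.2.1 (Subgroup.mem_sInf.1 hx L hL)
  have hΨ0 : L0 ≤ L0.comap Ψ := fun x hx => by
    rw [Subgroup.mem_comap, Subgroup.mem_sInf]
    intro L hL
    exact hL.2.2.2 (Subgroup.mem_sInf.1 hx L hL)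
  have hkC : p.ker ∈ C := by
    refine ⟨inferInstance, hR1, ?_, ?_⟩
    · intro x hx
      rw [MonoidHom.mem_ker] at hx
      rw [Subgroup.mem_comap, MonoidHom.mem_ker, hΦ, hx, map_one]
    · intro x hx
      rw [MonoidHom.mem_ker] at hx
      rw [Subgroup.mem_comap, MonoidHom.mem_ker, hΨ, hx, map_one]
  have hL0k : L0 ≤ p.ker := sInf_le hkC
  obtain ⟨φ0, hφ0⟩ := exists_quot_aut Φ Ψ L0 hΦ0 hΨ0 X hX
    (fun x hx => hR0 (Or.inl ⟨x, hx, rfl⟩)) (fun x hx => hR0 (Or.inr ⟨x, hx, rfl⟩))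
  let p0 : F ⧸ L0 →* K := QuotientGroup.lift L0 p hL0k
  have hp0 : ∀ a, p0 (φ0 a) = φ (p0 a) := by
    intro a
    obtain ⟨w, rfl⟩ := QuotientGroup.mk'_surjective L0 a
    rw [hφ0]
    exact hΦ w
  let P : (F ⧸ L0) ⋊[zpowersHom (MulAut (F ⧸ L0)) φ0] Multiplicative ℤ →*
      K ⋊[zpowersHom (MulAut K) φ] Multiplicative ℤ :=
    SemidirectProduct.map p0 (MonoidHom.id _) (zpowers_comm φ0 φ p0 hp0)
  have hP : Function.Surjective P := by
    rintro ⟨k, z⟩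
    obtain ⟨w, rfl⟩ := hp k
    exact ⟨⟨QuotientGroup.mk' L0 w, z⟩, rfl⟩
  have : Group.FG (F ⧸ L0) := Group.fg_of_surjective (QuotientGroup.mk'_surjective L0)
  have := semidirect_fg (zpowersHom (MulAut (F ⧸ L0)) φ0)
  obtain ⟨Y, hYf, hY⟩ := fp_ker P hP
  choose lf hlf using QuotientGroup.mk'_surjective L0
  refine ⟨R1 ∪ (fun y => lf (SemidirectProduct.left y)) '' Y,
    ((hXf.image _).union (hXf.image _)).union (hYf.image _), ?_, ?_⟩
  · rintro _ (h | ⟨y, hy, rfl⟩)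
    · exact hR1 h
    · have h1 : P y = 1 := by
        rw [← MonoidHom.mem_ker, ← hY]; exact Subgroup.subset_normalClosure hy
      have h2 : p0 y.left = 1 := congrArg SemidirectProduct.left h1
      rw [← hlf y.left] at h2
      exact h2
  · intro L hLn hRL hLΦ hLΨ
    have hL0L : L0 ≤ L := sInf_le ⟨hLn, fun x hx => hRL (Or.inl hx), hLΦ, hLΨ⟩
    obtain ⟨φL, hφL⟩ := exists_quot_aut Φ Ψ L hLΦ hLΨ X hX
      (fun x hx => hRL (Or.inl (Or.inl ⟨x, hx, rfl⟩)))
      (fun x hx => hRL (Or.inl (Or.inr ⟨x, hx, rfl⟩)))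
    let m : F ⧸ L0 →* F ⧸ L := QuotientGroup.lift L0 (QuotientGroup.mk' L) (by
      rw [QuotientGroup.ker_mk']; exact hL0L)
    have hm : ∀ a, m (φ0 a) = φL (m a) := by
      intro a
      obtain ⟨w, rfl⟩ := QuotientGroup.mk'_surjective L0 a
      rw [hφ0]
      exact (hφL w).symm
    let M : (F ⧸ L0) ⋊[zpowersHom (MulAut (F ⧸ L0)) φ0] Multiplicative ℤ →*
        (F ⧸ L) ⋊[zpowersHom (MulAut (F ⧸ L)) φL] Multiplicative ℤ :=
      SemidirectProduct.map m (MonoidHom.id _) (zpowers_comm φ0 φL m hm)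
    have hPM : P.ker ≤ M.ker := by
      rw [← hY]
      apply Subgroup.normalClosure_le_normal
      intro y hy
      have h1 : P y = 1 := by
        rw [← MonoidHom.mem_ker, ← hY]; exact Subgroup.subset_normalClosure hy
      have h2 : y.right = 1 := congrArg SemidirectProduct.right h1
      rw [SetLike.mem_coe, MonoidHom.mem_ker]
      have h3 : m y.left = 1 := by
        rw [← hlf y.left]
        exact (QuotientGroup.eq_one_iff _).2 (hRL (Or.inr ⟨y, hy, rfl⟩))
      apply SemidirectProduct.ext
      · exact h3
      · exact h2
    intro r hr
    have h4 : P (SemidirectProduct.inl (QuotientGroup.mk' L0 r)) = 1 := by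
      apply SemidirectProduct.ext
      · exact hr
      · rfl
    have h5 : m (QuotientGroup.mk' L0 r) = 1 := congrArg SemidirectProduct.left (MonoidHom.mem_ker.1 (hPM h4))
    exact (QuotientGroup.eq_one_iff r).1 h5

theorem conj_agree {F : Type*} [Group F] (L : Subgroup F) [L.Normal] (Θ : F →* F) (k : F)
    (T : Set F) (h : ∀ a ∈ T, (Θ a)⁻¹ * (k * a * k⁻¹) ∈ L) (a : F)
    (ha : a ∈ Subgroup.closure T) (haL : a ∈ L) : Θ a ∈ L := by
  have h1 : Set.EqOn ((QuotientGroup.mk' L).comp Θ)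
      ((QuotientGroup.mk' L).comp (MulAut.conj k).toMonoidHom) T := by
    intro a ha
    exact QuotientGroup.eq.2 (h a ha)
  have h2 : (Θ a)⁻¹ * (k * a * k⁻¹) ∈ L := QuotientGroup.eq.1 (MonoidHom.eqOn_closure h1 ha)
  have h3 : k * a * k⁻¹ ∈ L := Subgroup.Normal.conj_mem inferInstance a haL k
  have h4 := L.mul_mem h3 (L.inv_mem h2)
  simpa [mul_assoc] using h4

theorem zstep_core {K Q F : Type*} [Group K] [Group Q] [Group F] [hFfg : Group.FG F]
    [hQ : Group.IsFinitelyPresented Q] (φ : MulAut K)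
    (hΓ : Group.IsFinitelyPresented (K ⋊[zpowersHom (MulAut K) φ] Multiplicative ℤ))
    (π : K →* Q) (hπ : Function.Surjective π) (A B : Subgroup K) [hAn : A.Normal] [hBn : B.Normal]
    (hA : A.FG) (hB : B.FG) (hAB : A ⊓ B = ⊥) (hk : π.ker = A ⊔ B)
    (hφB : ∀ b ∈ B, φ b = b) (κ : K) (hφA : ∀ a ∈ A, φ a = κ * a * κ⁻¹)
    (p : F →* K) (hp : Function.Surjective p) (Φ Ψ : F →* F)
    (hΦ : ∀ w, p (Φ w) = φ (p w)) (hΨ : ∀ w, p (Ψ w) = φ⁻¹ (p w)) :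
    p.ker.IsFinitelyNormallyGenerated := by
  choose l hl using hp
  obtain ⟨X, hX, hXf⟩ := Group.fg_iff.1 hFfg
  have hφB' : ∀ b ∈ B, φ⁻¹ b = b := by
    intro b hb
    rw [MulAut.inv_apply, MulEquiv.symm_apply_eq, hφB b hb]
  have hφA' : ∀ a ∈ A, φ⁻¹ a = κ⁻¹ * a * κ := by
    intro a ha
    rw [MulAut.inv_apply, MulEquiv.symm_apply_eq]
    have : κ⁻¹ * a * κ ∈ A := by simpa using hAn.conj_mem a ha κ⁻¹
    rw [hφA _ this]
    group
  have lifts : ∀ C : Subgroup K, C.FG → ∃ T : Set F, T.Finite ∧ (∀ t ∈ T, p t ∈ C) ∧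
      ∀ c ∈ C, ∃ w ∈ Subgroup.closure T, p w = c := by
    intro C hC
    obtain ⟨S, hS, hSf⟩ := (Subgroup.fg_iff C).1 hC
    refine ⟨l '' S, hSf.image _, ?_, ?_⟩
    · rintro _ ⟨s, hs, rfl⟩
      rw [hl, ← hS]; exact Subgroup.subset_closure hs
    · intro c hc
      have : C = (Subgroup.closure (l '' S)).map p := by
        rw [MonoidHom.map_closure, Set.image_image]
        simp [hl, hS]
      rw [this] at hc
      exact hc
  obtain ⟨Ta, hTaf, hTaA, hTas⟩ := lifts A hA
  obtain ⟨Tb, hTbf, hTbB, hTbs⟩ := lifts B hB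
  have hcA : ∀ w : F, ∃ c : F, p w ∈ A → c ∈ Subgroup.closure Ta ∧ p c = p w := by
    intro w
    by_cases h : p w ∈ A
    · obtain ⟨c, hc⟩ := hTas _ h
      exact ⟨c, fun _ => hc⟩
    · exact ⟨1, fun h' => absurd h' h⟩
  have hcB : ∀ w : F, ∃ c : F, p w ∈ B → c ∈ Subgroup.closure Tb ∧ p c = p w := by
    intro w
    by_cases h : p w ∈ B
    · obtain ⟨c, hc⟩ := hTbs _ h
      exact ⟨c, fun _ => hc⟩
    · exact ⟨1, fun h' => absurd h' h⟩
  choose cA hcA using hcA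
  choose cB hcB using hcB
  let WA : Set F := Set.image2 (fun x a => x * a * x⁻¹) X Ta ∪ Set.image2 (fun x a => x⁻¹ * a * x) X Ta
  let WB : Set F := Set.image2 (fun x a => x * a * x⁻¹) X Tb ∪ Set.image2 (fun x a => x⁻¹ * a * x) X Tb
  have hWA : ∀ w ∈ WA, p w ∈ A := by
    rintro _ (⟨x, hx, a, ha, rfl⟩ | ⟨x, hx, a, ha, rfl⟩)
    · simpa using hAn.conj_mem _ (hTaA a ha) (p x)
    · simpa using hAn.conj_mem _ (hTaA a ha) (p x)⁻¹
  have hWB : ∀ w ∈ WB, p w ∈ B := by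
    rintro _ (⟨x, hx, a, ha, rfl⟩ | ⟨x, hx, a, ha, rfl⟩)
    · simpa using hBn.conj_mem _ (hTbB a ha) (p x)
    · simpa using hBn.conj_mem _ (hTbB a ha) (p x)⁻¹
  obtain ⟨Y, hYf, hY⟩ := fp_ker (π.comp p) (hπ.comp (fun k => ⟨l k, hl k⟩))
  have hYd : ∀ y : F, ∃ ab : F × F, y ∈ Y → ab.1 ∈ Subgroup.closure Ta ∧
      ab.2 ∈ Subgroup.closure Tb ∧ p y = p ab.1 * p ab.2 := by
    intro y
    by_cases h : y ∈ Y
    · have h1 : y ∈ (π.comp p).ker := hY ▸ Subgroup.subset_normalClosure h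
      have h2 : p y ∈ A ⊔ B := by rw [← hk]; exact h1
      obtain ⟨a, ha, b, hb, hab⟩ := Subgroup.mem_sup_of_normal_right.1 h2
      obtain ⟨a', ha', rfl⟩ := hTas a ha
      obtain ⟨b', hb', rfl⟩ := hTbs b hb
      exact ⟨(a', b'), fun _ => ⟨ha', hb', hab.symm⟩⟩
    · exact ⟨1, fun h' => absurd h' h⟩
  choose d hd using hYd
  let k : F := l κ
  have hkκ : p k = κ := hl κ
  let R1 : Set F := (fun w => w⁻¹ * cA w) '' WA ∪ (fun w => w⁻¹ * cB w) '' WB ∪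
    (fun y => y⁻¹ * ((d y).1 * (d y).2)) '' Y ∪
    (fun a => (Φ a)⁻¹ * (k * a * k⁻¹)) '' Ta ∪ (fun a => (Ψ a)⁻¹ * (k⁻¹ * a * k⁻¹⁻¹)) '' Ta ∪
    (fun a => (Φ a)⁻¹ * (1 * a * 1⁻¹)) '' Tb ∪ (fun a => (Ψ a)⁻¹ * (1 * a * 1⁻¹)) '' Tb
  have hR1f : R1.Finite := by
    have e1 : WA.Finite := (hXf.image2 _ hTaf).union (hXf.image2 _ hTaf)
    have e2 : WB.Finite := (hXf.image2 _ hTbf).union (hXf.image2 _ hTbf)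
    exact ((((((e1.image _).union (e2.image _)).union (hYf.image _)).union (hTaf.image _)).union
      (hTaf.image _)).union (hTbf.image _)).union (hTbf.image _)
  have hR1k : R1 ⊆ p.ker := by
    rintro _ ((((((⟨w, hw, rfl⟩ | ⟨w, hw, rfl⟩) | ⟨y, hy, rfl⟩) | ⟨a, ha, rfl⟩) | ⟨a, ha, rfl⟩) |
      ⟨a, ha, rfl⟩) | ⟨a, ha, rfl⟩)
    · simp [MonoidHom.mem_ker, (hcA w (hWA w hw)).2]
    · simp [MonoidHom.mem_ker, (hcB w (hWB w hw)).2]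
    · simp [MonoidHom.mem_ker, (hd y hy).2.2]
    · simp [MonoidHom.mem_ker, hΦ, hφA _ (hTaA a ha), hkκ, mul_assoc]
    · have := hφA' _ (hTaA a ha)
      simp only [SetLike.mem_coe, MonoidHom.mem_ker, map_mul, map_inv, hΨ, this, hkκ]
      group
    · simp [MonoidHom.mem_ker, hΦ, hφB _ (hTbB a ha)]
    · have := hφB' _ (hTbB a ha)
      simp only [SetLike.mem_coe, MonoidHom.mem_ker, map_mul, map_inv, hΨ, this, map_one]
      group
  let L1 := Subgroup.normalClosure R1
  have hdec : ∀ r ∈ p.ker, ∃ a ∈ Subgroup.closure Ta, ∃ b ∈ Subgroup.closure Tb,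
      p a = 1 ∧ p b = 1 ∧ r⁻¹ * (a * b) ∈ L1 := by
    let q := QuotientGroup.mk' L1
    have hqs : Function.Surjective q := QuotientGroup.mk'_surjective L1
    have hXq : Subgroup.closure (q '' X) = ⊤ := by
      rw [← MonoidHom.map_closure, hX]
      exact Subgroup.map_top_of_surjective _ hqs
    have hnA : (Subgroup.closure (q '' Ta)).Normal := by
      apply closure_normal_of_gens _ _ hXq
      · rintro _ ⟨x, hx, rfl⟩ _ ⟨a, ha, rfl⟩
        have hw : x * a * x⁻¹ ∈ WA := Or.inl ⟨x, hx, a, ha, rfl⟩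
        have : q (x * a * x⁻¹) = q (cA (x * a * x⁻¹)) := QuotientGroup.eq.2
          (Subgroup.subset_normalClosure (Or.inl (Or.inl (Or.inl (Or.inl (Or.inl (Or.inl ⟨_, hw, rfl⟩)))))))
        rw [← map_mul, ← map_inv, ← map_mul, this, ← MonoidHom.map_closure]
        exact ⟨_, (hcA _ (hWA _ hw)).1, rfl⟩
      · rintro _ ⟨x, hx, rfl⟩ _ ⟨a, ha, rfl⟩
        have hw : x⁻¹ * a * x ∈ WA := Or.inr ⟨x, hx, a, ha, rfl⟩
        have : q (x⁻¹ * a * x) = q (cA (x⁻¹ * a * x)) := QuotientGroup.eq.2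
          (Subgroup.subset_normalClosure (Or.inl (Or.inl (Or.inl (Or.inl (Or.inl (Or.inl ⟨_, hw, rfl⟩)))))))
        rw [← map_inv, ← map_mul, ← map_mul, this, ← MonoidHom.map_closure]
        exact ⟨_, (hcA _ (hWA _ hw)).1, rfl⟩
    have hnB : (Subgroup.closure (q '' Tb)).Normal := by
      apply closure_normal_of_gens _ _ hXq
      · rintro _ ⟨x, hx, rfl⟩ _ ⟨a, ha, rfl⟩
        have hw : x * a * x⁻¹ ∈ WB := Or.inl ⟨x, hx, a, ha, rfl⟩
        have : q (x * a * x⁻¹) = q (cB (x * a * x⁻¹)) := QuotientGroup.eq.2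
          (Subgroup.subset_normalClosure (Or.inl (Or.inl (Or.inl (Or.inl (Or.inl (Or.inr ⟨_, hw, rfl⟩)))))))
        rw [← map_mul, ← map_inv, ← map_mul, this, ← MonoidHom.map_closure]
        exact ⟨_, (hcB _ (hWB _ hw)).1, rfl⟩
      · rintro _ ⟨x, hx, rfl⟩ _ ⟨a, ha, rfl⟩
        have hw : x⁻¹ * a * x ∈ WB := Or.inr ⟨x, hx, a, ha, rfl⟩
        have : q (x⁻¹ * a * x) = q (cB (x⁻¹ * a * x)) := QuotientGroup.eq.2
          (Subgroup.subset_normalClosure (Or.inl (Or.inl (Or.inl (Or.inl (Or.inl (Or.inr ⟨_, hw, rfl⟩)))))))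
        rw [← map_inv, ← map_mul, ← map_mul, this, ← MonoidHom.map_closure]
        exact ⟨_, (hcB _ (hWB _ hw)).1, rfl⟩
    have hle : (π.comp p).ker ≤ (Subgroup.closure (q '' Ta) ⊔ Subgroup.closure (q '' Tb)).comap q := by
      rw [← hY]
      apply Subgroup.normalClosure_le_normal
      intro y hy
      have : q y = q ((d y).1 * (d y).2) := QuotientGroup.eq.2
          (Subgroup.subset_normalClosure (Or.inl (Or.inl (Or.inl (Or.inl (Or.inr ⟨_, hy, rfl⟩))))))
      rw [SetLike.mem_coe, Subgroup.mem_comap, this, map_mul, ← MonoidHom.map_closure,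
        ← MonoidHom.map_closure]
      exact Subgroup.mul_mem_sup ⟨_, (hd y hy).1, rfl⟩ ⟨_, (hd y hy).2.1, rfl⟩
    intro r hr
    have hr1 : r ∈ (π.comp p).ker := by
      rw [MonoidHom.mem_ker, MonoidHom.comp_apply, MonoidHom.mem_ker.1 hr, map_one]
    have hr2 := hle hr1
    rw [Subgroup.mem_comap, ← MonoidHom.map_closure, ← MonoidHom.map_closure] at hr2
    have : (Subgroup.map q (Subgroup.closure Tb)).Normal := by rw [MonoidHom.map_closure]; exact hnB
    obtain ⟨_, ⟨a, ha, rfl⟩, _, ⟨b, hb, rfl⟩, hab⟩ := Subgroup.mem_sup_of_normal_right.1 hr2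
    have hL : r⁻¹ * (a * b) ∈ L1 := by
      refine QuotientGroup.eq.1 (Eq.symm ?_)
      exact hab
    have hpA : ∀ a ∈ Subgroup.closure Ta, p a ∈ A := by
      have : Subgroup.closure Ta ≤ A.comap p := (Subgroup.closure_le _).2 hTaA
      exact this
    have hpB : ∀ a ∈ Subgroup.closure Tb, p a ∈ B := by
      have : Subgroup.closure Tb ≤ B.comap p := (Subgroup.closure_le _).2 hTbB
      exact this
    have hL1k : L1 ≤ p.ker := Subgroup.normalClosure_le_normal hR1k
    have h1 : p a * p b = 1 := by
      have := hL1k hL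
      simpa [MonoidHom.mem_ker, MonoidHom.mem_ker.1 hr] using this
    have h2 : p a = 1 := by
      have : p a ∈ A ⊓ B := ⟨hpA a ha, by
        rw [eq_inv_of_mul_eq_one_left h1]; exact B.inv_mem (hpB b hb)⟩
      rwa [hAB, Subgroup.mem_bot] at this
    exact ⟨a, ha, b, hb, h2, by rwa [h2, one_mul] at h1, hL⟩
  obtain ⟨R3, hR3f, hR3k, hR3⟩ := zstep_rel φ hΓ p (fun k => ⟨l k, hl k⟩) Φ Ψ hΦ hΨ
  have hdec' : ∀ r : F, ∃ ab : F × F, r ∈ p.ker → ab.1 ∈ Subgroup.closure Ta ∧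
      ab.2 ∈ Subgroup.closure Tb ∧ p ab.1 = 1 ∧ p ab.2 = 1 ∧ r⁻¹ * (ab.1 * ab.2) ∈ L1 := by
    intro r
    by_cases h : r ∈ p.ker
    · obtain ⟨a, ha, b, hb, h1, h2, h3⟩ := hdec r h
      exact ⟨(a, b), fun _ => ⟨ha, hb, h1, h2, h3⟩⟩
    · exact ⟨1, fun h' => absurd h' h⟩
  choose e he using hdec'
  let T : Set F := Φ '' R1 ∪ Ψ '' R1 ∪ R3
  have hTf : T.Finite := ((hR1f.image _).union (hR1f.image _)).union hR3f
  have hTk : ∀ r ∈ T, r ∈ p.ker := by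
    rintro _ ((⟨r, hr, rfl⟩ | ⟨r, hr, rfl⟩) | hr)
    · rw [MonoidHom.mem_ker, hΦ, MonoidHom.mem_ker.1 (hR1k hr), map_one]
    · rw [MonoidHom.mem_ker, hΨ, MonoidHom.mem_ker.1 (hR1k hr), map_one]
    · exact hR3k hr
  let Z : Set F := R1 ∪ (fun r => (e r).1) '' T ∪ (fun r => (e r).2) '' T
  have hZf : Z.Finite := (hR1f.union (hTf.image _)).union (hTf.image _)
  let L := Subgroup.normalClosure Z
  have hL1L : L1 ≤ L := Subgroup.normalClosure_mono (fun x hx => Or.inl (Or.inl hx))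
  have hTL : ∀ r ∈ T, r ∈ L := by
    intro r hr
    have h1 : r⁻¹ * ((e r).1 * (e r).2) ∈ L := hL1L (he r (hTk r hr)).2.2.2.2
    have h2 : (e r).1 ∈ L := Subgroup.subset_normalClosure (Or.inl (Or.inr ⟨r, hr, rfl⟩))
    have h3 : (e r).2 ∈ L := Subgroup.subset_normalClosure (Or.inr ⟨r, hr, rfl⟩)
    have h4 := L.mul_mem (L.mul_mem h2 h3) (L.inv_mem h1)
    simpa [mul_assoc] using h4
  have hsub : ∀ z ∈ R1, z ∈ L := fun z hz => hL1L (Subgroup.subset_normalClosure hz)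
  refine ⟨Z, hZf, le_antisymm ?_ (hR3 L inferInstance (fun r hr => hTL r (Or.inr hr)) ?_ ?_)⟩
  · apply Subgroup.normalClosure_le_normal
    rintro _ ((hr | ⟨r, hr, rfl⟩) | ⟨r, hr, rfl⟩)
    · exact hR1k hr
    · exact (he r (hTk r hr)).2.2.1
    · exact (he r (hTk r hr)).2.2.2.1
  · apply Subgroup.normalClosure_le_normal
    rintro _ ((hr | ⟨r, hr, rfl⟩) | ⟨r, hr, rfl⟩)
    · exact hTL _ (Or.inl (Or.inl ⟨_, hr, rfl⟩))
    · refine conj_agree L Φ k Ta (fun a ha => hsub _ ?_) _ (he r (hTk r hr)).1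
        (Subgroup.subset_normalClosure (Or.inl (Or.inr ⟨r, hr, rfl⟩)))
      exact Or.inl (Or.inl (Or.inl (Or.inr ⟨a, ha, rfl⟩)))
    · refine conj_agree L Φ 1 Tb (fun a ha => hsub _ ?_) _ (he r (hTk r hr)).2.1
        (Subgroup.subset_normalClosure (Or.inr ⟨r, hr, rfl⟩))
      exact Or.inl (Or.inr ⟨a, ha, rfl⟩)
  · apply Subgroup.normalClosure_le_normal
    rintro _ ((hr | ⟨r, hr, rfl⟩) | ⟨r, hr, rfl⟩)
    · exact hTL _ (Or.inl (Or.inr ⟨_, hr, rfl⟩))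
    · refine conj_agree L Ψ k⁻¹ Ta (fun a ha => hsub _ ?_) _ (he r (hTk r hr)).1
        (Subgroup.subset_normalClosure (Or.inl (Or.inr ⟨r, hr, rfl⟩)))
      exact Or.inl (Or.inl (Or.inr ⟨a, ha, rfl⟩))
    · refine conj_agree L Ψ 1 Tb (fun a ha => hsub _ ?_) _ (he r (hTk r hr)).2.1
        (Subgroup.subset_normalClosure (Or.inr ⟨r, hr, rfl⟩))
      exact Or.inr ⟨a, ha, rfl⟩

theorem zstep {K Q : Type*} [Group K] [Group Q] [hKfg : Group.FG K]
    [hQ : Group.IsFinitelyPresented Q] (φ : MulAut K)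
    (hΓ : Group.IsFinitelyPresented (K ⋊[zpowersHom (MulAut K) φ] Multiplicative ℤ))
    (π : K →* Q) (hπ : Function.Surjective π) (A B : Subgroup K) [hAn : A.Normal] [hBn : B.Normal]
    (hA : A.FG) (hB : B.FG) (hAB : A ⊓ B = ⊥) (hk : π.ker = A ⊔ B)
    (hφB : ∀ b ∈ B, φ b = b) (κ : K) (hφA : ∀ a ∈ A, φ a = κ * a * κ⁻¹) :
    Group.IsFinitelyPresented K := by
  obtain ⟨n, p, hp⟩ : ∃ (n : ℕ) (φ : FreeGroup (Fin n) →* K), Function.Surjective φ := by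
    obtain ⟨T, hT⟩ := Group.fg_def.1 hKfg
    refine ⟨T.card, FreeGroup.lift (fun i => (T.equivFin.symm i : K)), ?_⟩
    rw [← MonoidHom.range_eq_top, FreeGroup.range_lift_eq_closure, ← hT]
    congr 1
    ext x
    constructor
    · rintro ⟨i, rfl⟩; simp
    · intro hx; exact ⟨T.equivFin ⟨x, hx⟩, by simp⟩
  choose l hl using hp
  let lft : (K →* K) → (FreeGroup (Fin n) →* FreeGroup (Fin n)) :=
    fun θ => FreeGroup.lift (fun i => l (θ (p (FreeGroup.of i))))
  have hlft : ∀ θ w, p (lft θ w) = θ (p w) := by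
    intro θ
    have : p.comp (lft θ) = θ.comp p := by
      ext i
      simp [lft, hl]
    intro w
    exact DFunLike.congr_fun this w
  apply Group.IsFinitelyPresented.of_surjective p (fun k => ⟨l k, hl k⟩)
  exact zstep_core φ hΓ π hπ A B hA hB hAB hk hφB κ hφA p (fun k => ⟨l k, hl k⟩)
    (lft φ.toMonoidHom) (lft (φ⁻¹).toMonoidHom) (hlft _) (hlft _)

theorem fg_extension {K Q : Type*} [Group K] [Group Q] [hQ : Group.FG Q] (π : K →* Q)
    (hπ : Function.Surjective π) (hk : π.ker.FG) : Group.FG K := by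
  obtain ⟨S, hS, hSf⟩ := Group.fg_iff.1 hQ
  obtain ⟨T, hT, hTf⟩ := (Subgroup.fg_iff _).1 hk
  choose l hl using hπ
  refine Group.fg_iff.2 ⟨l '' S ∪ T, ?_, (hSf.image _).union hTf⟩
  rw [eq_top_iff]
  intro x _
  have h1 : (Subgroup.closure (l '' S ∪ T)).map π = ⊤ := by
    rw [eq_top_iff, ← hS, Subgroup.closure_le]
    intro s hs
    exact ⟨l s, Subgroup.subset_closure (Or.inl ⟨s, hs, rfl⟩), hl s⟩
  obtain ⟨y, hy, hxy⟩ : π x ∈ (Subgroup.closure (l '' S ∪ T)).map π := h1 ▸ Subgroup.mem_top _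
  have h2 : y⁻¹ * x ∈ π.ker := by rw [MonoidHom.mem_ker, map_mul, map_inv, hxy, inv_mul_cancel]
  rw [← hT] at h2
  have h3 := Subgroup.mul_mem _ hy (Subgroup.closure_mono Set.subset_union_right h2)
  simpa using h3

/-- One step: adding a generator to `N`. -/
theorem fib_step {G Q : Type*} [Group G] [hG : Group.IsFinitelyPresented G] [CommGroup Q]
    (N : Subgroup G) [N.Normal] (hN : N.FG) (q : G →* Q) (hq : Function.Surjective q)
    (hqk : ∀ g, g ∈ N ↔ q g = 1) (x : G) (H H' : Subgroup (G × G))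
    (hH : ∀ p : G × G, p ∈ H ↔ p.1 * p.2 ∈ N)
    (hH' : ∀ p : G × G, p ∈ H' ↔ p.1 * p.2 ∈ N ⊔ Subgroup.zpowers x)
    (hfp : Group.IsFinitelyPresented H') : Group.IsFinitelyPresented H := by
  have hHq : ∀ p : G × G, p ∈ H ↔ q p.1 * q p.2 = 1 := by
    intro p; rw [hH, hqk, map_mul]
  have hle : H ≤ H' := by
    intro p hp
    rw [hH] at hp
    rw [hH']
    exact (le_sup_left : N ≤ _) hp
  have hHn : H.Normal := by
    refine ⟨fun p hp g => ?_⟩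
    rw [hHq] at hp ⊢
    simp only [Prod.fst_mul, Prod.snd_mul, Prod.fst_inv, Prod.snd_inv, map_mul, map_inv]
    rw [← hp]
    rw [mul_right_comm (q g.1), mul_inv_cancel, one_mul, mul_right_comm (q g.2), mul_inv_cancel, one_mul]
  have hz : ∀ k : ℤ, ((x, 1) : G × G) ^ k = (x ^ k, 1) := by
    intro k
    ext <;> simp
  by_cases hx : ∃ k : ℤ, k ≠ 0 ∧ x ^ k ∈ N
  · obtain ⟨k, hk, hxk⟩ := hx
    let δ : H' →* Q := ((q.comp (MonoidHom.fst G G)) * (q.comp (MonoidHom.snd G G))).comp H'.subtype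
    have hδ : ∀ p : H', δ p = q p.1.1 * q p.1.2 := fun p => rfl
    have hr : δ.range ≤ Subgroup.zpowers (q x) := by
      rintro _ ⟨⟨p, hp⟩, rfl⟩
      rw [hδ, ← map_mul]
      rw [hH'] at hp
      obtain ⟨n, hn, _, ⟨j, rfl⟩, hj⟩ := Subgroup.mem_sup_of_normal_left.1 hp
      rw [← hj, map_mul, (hqk n).1 hn, one_mul]
      exact ⟨j, by simp⟩
    have hfo : IsOfFinOrder (q x) := by
      rw [isOfFinOrder_iff_zpow_eq_one]
      exact ⟨k, hk, by rw [← map_zpow, ← hqk]; exact hxk⟩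
    have : Finite (Subgroup.zpowers (q x)) := hfo.finite_zpowers
    have : Finite δ.range := Finite.of_injective _ (Subgroup.inclusion_injective hr)
    have hk : δ.ker = H.subgroupOf H' := by
      ext p
      rw [MonoidHom.mem_ker, hδ, Subgroup.mem_subgroupOf, hHq]
    have : (H.subgroupOf H').FiniteIndex := hk ▸ inferInstance
    have := fp_of_finiteIndex (H.subgroupOf H')
    exact Group.IsFinitelyPresented.equiv (Subgroup.subgroupOfEquivOfLe hle)
  · push Not at hx
    let φ : MulAut H := MulAut.conjNormal ((x, 1) : G × G)
    have hφ : ∀ h : H, ((φ h : H) : G × G) = ((x, 1) : G × G) * (h : G × G) * ((x, 1) : G × G)⁻¹ := fun h => rfl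
    let f : H ⋊[zpowersHom (MulAut H) φ] Multiplicative ℤ →* G × G :=
      SemidirectProduct.lift H.subtype (zpowersHom (G × G) ((x, 1) : G × G)) (by
        intro g
        ext1 h
        simp only [φ, zpowersHom_apply, ← map_zpow, MonoidHom.comp_apply]
        rfl)
    have hf : ∀ (h : H) (k : ℤ), f ⟨h, Multiplicative.ofAdd k⟩ = (h : G × G) * ((x ^ k, 1) : G × G) := by
      intro h k
      rw [← hz]; rfl
    have hinj : Function.Injective f := by
      rw [← MonoidHom.ker_eq_bot_iff, eq_bot_iff]
      rintro ⟨h, k⟩ hk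
      change f ⟨h, Multiplicative.ofAdd k.toAdd⟩ = 1 at hk
      rw [hf] at hk
      have h1 : ((x ^ k.toAdd, 1) : G × G) ∈ H := by
        rw [← inv_eq_of_mul_eq_one_right hk]
        exact H.inv_mem h.2
      have h2 : x ^ k.toAdd ∈ N := by
        rw [hH] at h1
        simpa using h1
      have h3 : k.toAdd = 0 := by
        by_contra h0
        exact hx _ h0 h2
      rw [h3] at hk
      have h4 : h = 1 := by
        apply Subtype.ext
        simpa [← Prod.one_eq_mk] using hk
      have h5 : k = 1 := h3
      rw [h4, h5]
      exact Subgroup.mem_bot.2 rfl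
    have hrange : f.range = H' := by
      apply le_antisymm
      · rintro _ ⟨⟨h, k⟩, rfl⟩
        change f ⟨h, Multiplicative.ofAdd k.toAdd⟩ ∈ H'
        rw [hf]
        refine H'.mul_mem (hle h.2) ?_
        rw [hH']
        simp only [mul_one]
        exact (le_sup_right : Subgroup.zpowers x ≤ _) ⟨_, rfl⟩
      · intro p hp
        rw [hH'] at hp
        obtain ⟨n, hn, _, ⟨j, rfl⟩, hj⟩ := Subgroup.mem_sup_of_normal_left.1 hp
        have h1 : p * (x ^ j, 1)⁻¹ ∈ H := by
          rw [hHq]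
          simp only [Prod.fst_mul, Prod.snd_mul, Prod.fst_inv, Prod.snd_inv, map_mul, map_inv,
            inv_one, mul_one]
          rw [mul_right_comm, ← map_mul, ← hj, map_mul, (hqk n).1 hn, one_mul, mul_inv_cancel]
        refine ⟨⟨⟨_, h1⟩, Multiplicative.ofAdd j⟩, ?_⟩
        rw [hf]
        exact inv_mul_cancel_right p _
    have hΓ : Group.IsFinitelyPresented (H ⋊[zpowersHom (MulAut H) φ] Multiplicative ℤ) := by
      have e1 : (H ⋊[zpowersHom (MulAut H) φ] Multiplicative ℤ) ≃* f.range := MonoidHom.ofInjective hinj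
      have e2 : f.range ≃* H' := MulEquiv.subgroupCongr hrange
      exact Group.IsFinitelyPresented.equiv (e1.trans e2).symm
    have hNfg : Group.FG N := (Group.fg_iff_subgroup_fg N).2 hN
    have hQ : Group.IsFinitelyPresented Q := by
      apply Group.IsFinitelyPresented.of_surjective q hq
      have : q.ker = N := by ext g; rw [hqk, MonoidHom.mem_ker]
      rw [this]
      exact Subgroup.IsFinitelyNormallyGenerated.of_FG N
    have hQfg : Group.FG Q := fp_fg
    let π : H →* Q := (q.comp (MonoidHom.fst G G)).comp H.subtype
    have hπ' : ∀ h : H, π h = q h.1.1 := fun h => rfl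
    have hπ : Function.Surjective π := by
      intro y
      obtain ⟨g, rfl⟩ := hq y
      exact ⟨⟨(g, g⁻¹), by rw [hH]; simp⟩, rfl⟩
    let A : Subgroup H := (N.prod ⊥).subgroupOf H
    let B : Subgroup H := (Subgroup.prod ⊥ N).subgroupOf H
    have hAle : N.prod ⊥ ≤ H := by
      rintro ⟨a, b⟩ ⟨ha, hb⟩
      have hb : b = 1 := hb
      rw [hH]
      simpa [hb] using ha
    have hBle : Subgroup.prod ⊥ N ≤ H := by
      rintro ⟨a, b⟩ ⟨ha, hb⟩
      have ha : a = 1 := ha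
      rw [hH]
      simpa [ha] using hb
    have hAmem : ∀ h : H, h ∈ A ↔ h.1.1 ∈ N ∧ h.1.2 = 1 := by
      intro h
      rw [Subgroup.mem_subgroupOf, Subgroup.mem_prod, Subgroup.mem_bot]
    have hBmem : ∀ h : H, h ∈ B ↔ h.1.1 = 1 ∧ h.1.2 ∈ N := by
      intro h
      rw [Subgroup.mem_subgroupOf, Subgroup.mem_prod, Subgroup.mem_bot]
    have hbot : (⊥ : Subgroup G).FG := ⟨∅, by simp⟩
    have trans : ∀ C : Subgroup (G × G), C ≤ H → C.FG → (C.subgroupOf H).FG := by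
      intro C hC hCfg
      rw [← Group.fg_iff_subgroup_fg] at hCfg ⊢
      exact Group.fg_of_surjective (f := (Subgroup.subgroupOfEquivOfLe hC).symm.toMonoidHom)
        (Subgroup.subgroupOfEquivOfLe hC).symm.surjective
    have hA : A.FG := trans _ hAle (Subgroup.FG.prod hN hbot)
    have hB : B.FG := trans _ hBle (Subgroup.FG.prod hbot hN)
    have hAn : A.Normal := inferInstance
    have hBn : B.Normal := inferInstance
    have hAB : A ⊓ B = ⊥ := by
      rw [eq_bot_iff]
      intro h hh
      have h1 := ((hAmem h).1 hh.1).2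
      have h2 := ((hBmem h).1 hh.2).1
      rw [Subgroup.mem_bot]
      exact Subtype.ext (Prod.ext h2 h1)
    have hk : π.ker = A ⊔ B := by
      apply le_antisymm
      · intro h hh
        rw [MonoidHom.mem_ker, hπ', ← hqk] at hh
        have h2 : h.1.2 ∈ N := by
          have := (hH _).1 h.2
          exact (Subgroup.mul_mem_cancel_left N hh).1 this
        rw [Subgroup.mem_sup_of_normal_left]
        refine ⟨⟨(h.1.1, 1), hAle ⟨hh, rfl⟩⟩, (hAmem _).2 ⟨hh, rfl⟩, ⟨(1, h.1.2), hBle ⟨rfl, h2⟩⟩,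
          (hBmem _).2 ⟨rfl, h2⟩, ?_⟩
        apply Subtype.ext
        ext <;> simp
      · refine sup_le ?_ ?_
        · intro h hh
          rw [MonoidHom.mem_ker, hπ', ← hqk]
          exact ((hAmem h).1 hh).1
        · intro h hh
          rw [MonoidHom.mem_ker, hπ', ((hBmem h).1 hh).1, map_one]
    have hHfg : Group.FG H := fg_extension π hπ (by rw [hk]; exact hA.sup hB)
    refine zstep φ hΓ π hπ A B hA hB hAB hk ?_ ⟨(x, x⁻¹), by rw [hH]; simp⟩ ?_
    · intro b hb
      apply Subtype.ext
      rw [hφ]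
      have := (hBmem b).1 hb
      ext <;> simp [this]
    · intro a ha
      apply Subtype.ext
      rw [hφ]
      have := (hAmem a).1 ha
      ext <;> simp [this]

theorem exists_fib {G : Type*} [Group G] (N : Subgroup G) [N.Normal] (hc : commutator G ≤ N) :
    (∃ H : Subgroup (G × G), ∀ p : G × G, p ∈ H ↔ p.1 * p.2 ∈ N) := by
  let i : CommGroup (G ⧸ N) := { (inferInstance : Group (G ⧸ N)) with
    mul_comm := by
      intro a b
      obtain ⟨a, rfl⟩ := QuotientGroup.mk_surjective a
      obtain ⟨b, rfl⟩ := QuotientGroup.mk_surjective b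
      refine QuotientGroup.eq.2 (hc ?_)
      have := Subgroup.commutator_mem_commutator (Subgroup.mem_top b⁻¹) (Subgroup.mem_top a⁻¹)
      simpa [commutatorElement_def, mul_assoc, commutator] using this }
  let q : G →* G ⧸ N := QuotientGroup.mk' N
  refine ⟨((q.comp (MonoidHom.fst G G)) * (q.comp (MonoidHom.snd G G))).ker, ?_⟩
  intro p
  rw [MonoidHom.mem_ker]
  exact QuotientGroup.eq_one_iff (p.1 * p.2)

theorem exists_comm_quot.{u} {G : Type u} [Group G] (N : Subgroup G) [N.Normal] (hc : commutator G ≤ N) :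
    (∃ (Q : Type u) (_ : CommGroup Q) (q : G →* Q), Function.Surjective q ∧ ∀ g, g ∈ N ↔ q g = 1) := by
  let i : CommGroup (G ⧸ N) := { (inferInstance : Group (G ⧸ N)) with
    mul_comm := by
      intro a b
      obtain ⟨a, rfl⟩ := QuotientGroup.mk_surjective a
      obtain ⟨b, rfl⟩ := QuotientGroup.mk_surjective b
      refine QuotientGroup.eq.2 (hc ?_)
      have := Subgroup.commutator_mem_commutator (Subgroup.mem_top b⁻¹) (Subgroup.mem_top a⁻¹)
      simpa [commutatorElement_def, mul_assoc, commutator] using this }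
  exact ⟨G ⧸ N, i, QuotientGroup.mk' N, QuotientGroup.mk'_surjective N,
    fun g => (QuotientGroup.eq_one_iff g).symm⟩

theorem normal_of_commutator_le {G : Type*} [Group G] (N : Subgroup G) (hc : commutator G ≤ N) :
    N.Normal := by
  refine ⟨fun n hn g => ?_⟩
  have h1 := hc (Subgroup.commutator_mem_commutator (Subgroup.mem_top g) (Subgroup.mem_top n))
  have := N.mul_mem h1 hn
  simpa [commutatorElement_def, mul_assoc] using this

theorem fib_fp_of_fg {G : Type*} [Group G] [hG : Group.IsFinitelyPresented G] (s : Finset G) :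
    ∀ (N : Subgroup G), commutator G ≤ N → N.FG → N ⊔ Subgroup.closure (s : Set G) = ⊤ →
    ∀ H : Subgroup (G × G), (∀ p : G × G, p ∈ H ↔ p.1 * p.2 ∈ N) →
    Group.IsFinitelyPresented H := by
  classical
  induction s using Finset.induction_on with
  | empty =>
    intro N hc hN hs H hH
    simp only [Finset.coe_empty, Subgroup.closure_empty, bot_le, sup_of_le_left] at hs
    have : H = ⊤ := by
      rw [eq_top_iff]
      intro p _
      rw [hH, hs]; exact Subgroup.mem_top _
    have := fp_prod (A := G) (B := G)
    subst H
    exact Group.IsFinitelyPresented.equiv (Subgroup.topEquiv (G := G × G)).symm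
  | insert x s hx ih =>
    intro N hc hN hs H hH
    have hn := normal_of_commutator_le N hc
    have hc' : commutator G ≤ N ⊔ Subgroup.zpowers x := hc.trans le_sup_left
    have hn' := normal_of_commutator_le _ hc'
    obtain ⟨H', hH'⟩ := exists_fib (N ⊔ Subgroup.zpowers x) hc'
    have hz : (Subgroup.zpowers x).FG := ⟨{x}, by simp [Subgroup.zpowers_eq_closure]⟩
    have h1 := ih _ hc' (hN.sup hz) (by
      rw [← hs, Finset.coe_insert, Set.insert_eq, Subgroup.closure_union,
        Subgroup.zpowers_eq_closure, sup_assoc]) H' hH'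
    obtain ⟨Q, i, q, hq, hqk⟩ := exists_comm_quot N hc
    exact fib_step N hN q hq hqk x H H' hH hH' h1

theorem backward {G : Type*} [Group G] [hG : Group.IsFinitelyPresented G] (N : Subgroup G)
    (hc : commutator G ≤ N) (hN : N.FG) (H : Subgroup (G × G))
    (hH : ∀ p : G × G, p ∈ H ↔ p.1 * p.2 ∈ N) : Group.IsFinitelyPresented H := by
  obtain ⟨s, hs⟩ := Group.fg_def.1 (fp_fg (A := G))
  exact fib_fp_of_fg s N hc hN (by rw [hs]; simp) H hH

/-- The permutation of `Γ × ZMod 2` given by left translation and a cocycle. -/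
def cocPerm {Γ : Type*} [Group Γ] (s : Γ) (b : Γ → ZMod 2) : Equiv.Perm (Γ × ZMod 2) where
  toFun x := (s * x.1, x.2 + b x.1)
  invFun x := (s⁻¹ * x.1, x.2 - b (s⁻¹ * x.1))
  left_inv x := by simp
  right_inv x := by simp

theorem exists_cocycle_prim {Γ : Type*} [Group Γ] (S : Set Γ) (f : FreeGroup S →* Γ)
    (hfS : ∀ s : S, f (FreeGroup.of s) = s)
    (hf : Function.Surjective f) (R : Set (FreeGroup S)) (hR : R.Finite)
    (hRk : Subgroup.normalClosure R = f.ker) (η : Γ → ℝ) (hη : ∀ a b, η (a * b) = η a + η b)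
    (β : ℝ → S → Γ → ZMod 2) (D : ℝ → Γ → ZMod 2)
    (hp : ∀ c, 0 ≤ c → ∀ (s : S) h, -c ≤ η h → -c ≤ η (s * h) → β c s h = D c h + D c (s * h))
    (hm : ∀ c, 0 ≤ c → ∀ (s : S) h, η h ≤ c → η (s * h) ≤ c → β c s h = 0) :
    ∃ c0 : ℝ, 0 ≤ c0 ∧ ∀ c, c0 ≤ c → ∃ φ : Γ → ZMod 2, ∀ (s : S) h, φ (s * h) = φ h + β c s h := by
  have hη1 : η 1 = 0 := by have := hη 1 1; simp at this; exact this
  have hηinv : ∀ a, η a⁻¹ = - η a := by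
    intro a
    have := hη a a⁻¹
    rw [mul_inv_cancel, hη1] at this
    linarith
  let ρ : ℝ → FreeGroup S →* Equiv.Perm (Γ × ZMod 2) :=
    fun c => FreeGroup.lift (fun s : S => cocPerm (s : Γ) (β c s))
  have hρ : ∀ c (s : S) x, ρ c (FreeGroup.of s) x = (s * x.1, x.2 + β c s x.1) := by
    intro c s x
    simp [ρ, cocPerm]
  have hfst : ∀ c w x, (ρ c w x).1 = f w * x.1 := by
    intro c w
    induction w using FreeGroup.induction_on with
    | C1 => intro x; simp
    | of s => intro x; rw [hρ, hfS]
    | inv_of s ih =>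
      intro x
      have := ih ((ρ c (FreeGroup.of s)⁻¹) x)
      rw [← Equiv.Perm.mul_apply, ← map_mul, mul_inv_cancel, map_one, Equiv.Perm.one_apply] at this
      rw [this, map_inv f, inv_mul_cancel_left]
    | mul x y hx hy => intro z; rw [map_mul, Equiv.Perm.mul_apply, hx, hy, map_mul, mul_assoc]
  let P : FreeGroup S → ℝ → Prop := fun w B => 0 ≤ B ∧ ∀ c, 0 ≤ c → ∀ h ε,
    (-c + B ≤ η h → (ρ c w (h, ε)).2 = ε + D c h + D c (f w * h)) ∧
    (η h ≤ c - B → (ρ c w (h, ε)).2 = ε)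
  have two : ∀ x : ZMod 2, x + x = 0 := by decide
  have hP : ∀ w, ∃ B, P w B := by
    intro w
    induction w using FreeGroup.induction_on with
    | C1 =>
      refine ⟨0, le_rfl, fun c hc h ε => ⟨fun _ => ?_, fun _ => ?_⟩⟩
      · simp only [map_one, Equiv.Perm.one_apply, one_mul]
        rw [add_assoc, two, add_zero]
      · simp
    | of s =>
      refine ⟨|η s|, abs_nonneg _, fun c hc h ε => ⟨fun hh => ?_, fun hh => ?_⟩⟩
      · rw [hρ, hfS, hp c hc s h, add_assoc]
        · have := abs_nonneg (η s); linarith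
        · rw [hη]; have := neg_abs_le (η s); linarith
      · rw [hρ, hm c hc s h, add_zero]
        · have := abs_nonneg (η s); linarith
        · rw [hη]; have := le_abs_self (η s); linarith
    | inv_of s ih =>
      obtain ⟨B, hB0, hB⟩ := ih
      refine ⟨B + |η s|, by positivity, fun c hc h ε => ?_⟩
      obtain ⟨h1, h2⟩ := hB c hc (f (FreeGroup.of s)⁻¹ * h) ((ρ c (FreeGroup.of s)⁻¹ (h, ε)).2)
      have he : ρ c (FreeGroup.of s) (f (FreeGroup.of s)⁻¹ * h, (ρ c (FreeGroup.of s)⁻¹ (h, ε)).2)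
          = (h, ε) := by
        have : (f (FreeGroup.of s)⁻¹ * h, (ρ c (FreeGroup.of s)⁻¹ (h, ε)).2) =
            ρ c (FreeGroup.of s)⁻¹ (h, ε) := by
          apply Prod.ext
          · rw [hfst]
          · rfl
        rw [this, ← Equiv.Perm.mul_apply, ← map_mul, mul_inv_cancel, map_one, Equiv.Perm.one_apply]
      rw [he] at h1 h2
      have hv : η (f (FreeGroup.of s)⁻¹ * h) = - η s + η h := by rw [map_inv, hfS, hη, hηinv]
      rw [hv] at h1 h2
      refine ⟨fun hh => ?_, fun hh => ?_⟩
      · have := h1 (by have := le_abs_self (η s); linarith)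
        rw [map_inv f, mul_inv_cancel_left] at this
        simp only at this
        rw [map_inv f]
        generalize ((ρ c) (FreeGroup.of s)⁻¹ (h, ε)).2 = z at *
        generalize D c h = p at *
        generalize D c ((f (FreeGroup.of s))⁻¹ * h) = q at *
        have h1 := two p
        have h2 := two q
        rw [this]
        linear_combination (-1 : ZMod 2) * h1 - h2
      · exact (h2 (by have := neg_abs_le (η s); linarith)).symm
    | mul x y hx hy =>
      obtain ⟨B, hB0, hB⟩ := hx
      obtain ⟨C, hC0, hC⟩ := hy
      refine ⟨B + C + |η (f y)|, by positivity, fun c hc h ε => ?_⟩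
      have he : ρ c (x * y) (h, ε) = ρ c x (f y * h, (ρ c y (h, ε)).2) := by
        rw [map_mul, Equiv.Perm.mul_apply]
        congr 1
        apply Prod.ext
        · rw [hfst]
        · rfl
      rw [he]
      obtain ⟨h1, h2⟩ := hB c hc (f y * h) ((ρ c y (h, ε)).2)
      obtain ⟨h3, h4⟩ := hC c hc h ε
      rw [hη] at h1 h2
      have e1 := abs_nonneg (η (f y))
      have e2 := le_abs_self (η (f y))
      have e3 := neg_abs_le (η (f y))
      refine ⟨fun hh => ?_, fun hh => ?_⟩
      · rw [h1 (by linarith), h3 (by linarith), map_mul, mul_assoc]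
        have := two (D c (f y * h))
        linear_combination this
      · rw [h2 (by linarith), h4 (by linarith)]
  choose B hB using hP
  obtain ⟨c0, hc0⟩ : ∃ c0, ∀ r ∈ R, B r ≤ c0 := by
    obtain ⟨c0, hc0⟩ := (hR.image B).bddAbove
    exact ⟨c0, fun r hr => hc0 ⟨r, hr, rfl⟩⟩
  refine ⟨max c0 0, le_max_right _ _, fun c hc => ?_⟩
  have hc' : c0 ≤ c := (le_max_left _ _).trans hc
  have hc'' : 0 ≤ c := (le_max_right _ _).trans hc
  have hker : f.ker ≤ (ρ c).ker := by
    rw [← hRk]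
    apply Subgroup.normalClosure_le_normal
    intro r hr
    have hfr : f r = 1 := by
      rw [← MonoidHom.mem_ker, ← hRk]; exact Subgroup.subset_normalClosure hr
    rw [SetLike.mem_coe, MonoidHom.mem_ker]
    ext1 ⟨h, ε⟩
    obtain ⟨h1, h2⟩ := (hB r).2 c hc'' h ε
    have hb := hc0 r hr
    apply Prod.ext
    · rw [hfst, hfr, one_mul]; rfl
    · rcases le_total 0 (η h) with h0 | h0
      · rw [h1 (by linarith), hfr, one_mul, add_assoc, two, add_zero]; rfl
      · rw [h2 (by linarith)]; rfl
  choose l hl using hf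
  refine ⟨fun h => (ρ c (l h) (1, 0)).2, fun s h => ?_⟩
  have h1 : ρ c (l (s * h)) = ρ c (FreeGroup.of s * l h) := by
    have : (l (s * h))⁻¹ * (FreeGroup.of s * l h) ∈ f.ker := by
      rw [MonoidHom.mem_ker, map_mul, map_mul, map_inv, hl, hl, hfS]; simp
    have := hker this
    rw [MonoidHom.mem_ker, map_mul, map_inv] at this
    exact inv_mul_eq_one.1 this
  simp only
  rw [h1, map_mul, Equiv.Perm.mul_apply, hρ, hfst, hl, mul_one]

/-- A Cayley graph step inside `U`. -/
def Stp {Γ : Type*} [Group Γ] (S U : Set Γ) (a b : Γ) : Prop := a ∈ U ∧ b ∈ U ∧ ∃ s ∈ S, b = s * a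

/-- Connectedness inside `U`. -/
def Cn {Γ : Type*} [Group Γ] (S U : Set Γ) : Γ → Γ → Prop := Relation.ReflTransGen (Stp S U)

theorem Cn.refl {Γ : Type*} [Group Γ] {S U : Set Γ} (a : Γ) : Cn S U a a := Relation.ReflTransGen.refl

theorem Cn.trans {Γ : Type*} [Group Γ] {S U : Set Γ} {a b c : Γ} (h : Cn S U a b) (h' : Cn S U b c) :
    Cn S U a c := Relation.ReflTransGen.trans h h'

theorem Cn.step {Γ : Type*} [Group Γ] {S U : Set Γ} {a s : Γ} (hs : s ∈ S) (ha : a ∈ U)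
    (hb : s * a ∈ U) : Cn S U a (s * a) := Relation.ReflTransGen.single ⟨ha, hb, s, hs, rfl⟩

theorem Cn.symm {Γ : Type*} [Group Γ] {S U : Set Γ} (hS : ∀ s ∈ S, s⁻¹ ∈ S) {a b : Γ}
    (h : Cn S U a b) : Cn S U b a := by
  induction h with
  | refl => exact Cn.refl _
  | tail _ h ih =>
    obtain ⟨h1, h2, s, hs, rfl⟩ := h
    refine Cn.trans (Relation.ReflTransGen.single ⟨h2, h1, s⁻¹, hS s hs, ?_⟩) ih
    simp

theorem Cn.map {Γ Δ : Type*} [Group Γ] [Group Δ] {S U : Set Γ} {S' U' : Set Δ} (f : Γ →* Δ) (g : Δ)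
    (hS : ∀ s ∈ S, f s ∈ S') (hU : ∀ u ∈ U, f u * g ∈ U') {a b : Γ} (h : Cn S U a b) :
    Cn S' U' (f a * g) (f b * g) := by
  induction h with
  | refl => exact Cn.refl _
  | tail _ h ih =>
    obtain ⟨h1, h2, s, hs, rfl⟩ := h
    refine ih.trans (Relation.ReflTransGen.single ⟨hU _ h1, hU _ h2, f s, hS s hs, ?_⟩)
    rw [map_mul, mul_assoc]

theorem Cn.right {Γ : Type*} [Group Γ] {S U U' : Set Γ} (g : Γ)
    (hU : ∀ u ∈ U, u * g ∈ U') {a b : Γ} (h : Cn S U a b) : Cn S U' (a * g) (b * g) :=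
  Cn.map (MonoidHom.id Γ) g (fun _ hs => hs) hU h

theorem Cn.mono {Γ : Type*} [Group Γ] {S U S' U' : Set Γ} (hS : S ⊆ S') (hU : U ⊆ U') {a b : Γ}
    (h : Cn S U a b) : Cn S' U' a b := by
  have := Cn.map (S' := S') (U' := U') (MonoidHom.id Γ) 1 hS (fun u hu => by simpa using hU hu) h
  simpa using this

theorem crux {Γ : Type*} [Group Γ] (S : Set Γ) (hS : ∀ s ∈ S, s⁻¹ ∈ S) (f : FreeGroup S →* Γ)
    (hfS : ∀ s : S, f (FreeGroup.of s) = s)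
    (hf : Function.Surjective f) (R : Set (FreeGroup S)) (hR : R.Finite)
    (hRk : Subgroup.normalClosure R = f.ker) (η : Γ → ℝ) (hη : ∀ a b, η (a * b) = η a + η b)
    (τ : Γ →* Γ) (hττ : ∀ g, τ (τ g) = g) (hτS : ∀ s ∈ S, τ s ∈ S) (hητ : ∀ g, η (τ g) = - η g) :
    ∃ c0 : ℝ, 0 ≤ c0 ∧ ∀ c, c0 ≤ c → ∀ u, η u = 0 → Commute u (τ u) →
      Cn S {g | η g ≤ c} 1 u → Cn S {g | -c ≤ η g} 1 u := by
  classical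
  let D : ℝ → Γ → ZMod 2 := fun c h =>
    if Cn S {g | η g ≤ c} 1 h ∧ Cn S {g | -c ≤ η g} 1 h then 1 else 0
  let β : ℝ → S → Γ → ZMod 2 := fun c s h =>
    if -c ≤ η h ∧ -c ≤ η (s * h) then D c h + D c (s * h) else 0
  have two : ∀ x : ZMod 2, x + x = 0 := by decide
  have hp : ∀ c, 0 ≤ c → ∀ (s : S) h, -c ≤ η h → -c ≤ η (s * h) → β c s h = D c h + D c (s * h) :=
    fun c _ s h h1 h2 => if_pos ⟨h1, h2⟩
  have hm : ∀ c, 0 ≤ c → ∀ (s : S) h, η h ≤ c → η (s * h) ≤ c → β c s h = 0 := by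
    intro c hc s h h1 h2
    by_cases hh : -c ≤ η h ∧ -c ≤ η (s * h)
    · have e1 : Cn S {g | η g ≤ c} h (s * h) := Cn.step s.2 h1 h2
      have e2 : Cn S {g | -c ≤ η g} h (s * h) := Cn.step s.2 hh.1 hh.2
      have : D c h = D c (s * h) := by
        have : (Cn S {g | η g ≤ c} 1 h ∧ Cn S {g | -c ≤ η g} 1 h) ↔
            (Cn S {g | η g ≤ c} 1 (s * h) ∧ Cn S {g | -c ≤ η g} 1 (s * h)) :=
          ⟨fun h => ⟨h.1.trans e1, h.2.trans e2⟩, fun h => ⟨h.1.trans (e1.symm hS), h.2.trans (e2.symm hS)⟩⟩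
        simp only [D, this]
      rw [hp c hc s h hh.1 hh.2, this, two]
    · exact if_neg hh
  obtain ⟨c0, hc0, hc⟩ := exists_cocycle_prim S f hfS hf R hR hRk η hη β D hp hm
  refine ⟨c0, hc0, fun c hcc u hu hcomm hum => ?_⟩
  have hcpos := hc0.trans hcc
  obtain ⟨φ, hφ⟩ := hc c hcc
  have hη1 : η 1 = 0 := by have := hη 1 1; simp at this; exact this
  have cm : ∀ a b, Cn S {g | η g ≤ c} a b → φ a = φ b := by
    intro a b h
    induction h with
    | refl => rfl
    | tail _ h ih =>
      obtain ⟨h1, h2, s, hs, rfl⟩ := h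
      rw [ih, hφ ⟨s, hs⟩, hm c hcpos ⟨s, hs⟩ _ h1 h2, add_zero]
  have cp : ∀ a b, Cn S {g | -c ≤ η g} a b → φ a + D c a = φ b + D c b := by
    intro a b h
    induction h with
    | refl => rfl
    | tail _ h ih =>
      obtain ⟨h1, h2, s, hs, rfl⟩ := h
      rw [ih, hφ ⟨s, hs⟩, hp c hcpos ⟨s, hs⟩ _ h1 h2]
      linear_combination (-1 : ZMod 2) * two (D c (s * _))
  have flip1 : ∀ a b, Cn S {g | η g ≤ c} a b → Cn S {g | -c ≤ η g} (τ a) (τ b) := by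
    intro a b h
    have := Cn.map (S' := S) (U' := {g | -c ≤ η g}) τ 1 hτS (fun x hx => by
      simp only [Set.mem_setOf_eq, mul_one, hητ] at hx ⊢; linarith) h
    simpa using this
  have flip2 : ∀ a b, Cn S {g | -c ≤ η g} a b → Cn S {g | η g ≤ c} (τ a) (τ b) := by
    intro a b h
    have := Cn.map (S' := S) (U' := {g | η g ≤ c}) τ 1 hτS (fun x hx => by
      simp only [Set.mem_setOf_eq, mul_one, hητ] at hx ⊢; linarith) h
    simpa using this
  by_contra hup
  have hv : η (τ u) = 0 := by rw [hητ, hu, neg_zero]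
  have hvp : Cn S {g | -c ≤ η g} 1 (τ u) := by simpa using flip1 _ _ hum
  have hvm : ¬ Cn S {g | η g ≤ c} 1 (τ u) := by
    intro h
    have := flip1 _ _ h
    rw [map_one, hττ] at this
    exact hup this
  have hvw : Cn S {g | η g ≤ c} (τ u) (u * τ u) := by
    have := Cn.right (U' := {g | η g ≤ c}) (τ u) (fun x hx => by
      simp only [Set.mem_setOf_eq, hη, hv, add_zero] at hx ⊢; exact hx) hum
    simpa using this
  have huw : Cn S {g | -c ≤ η g} u (u * τ u) := by
    have := Cn.right (U' := {g | -c ≤ η g}) u (fun x hx => by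
      simp only [Set.mem_setOf_eq, hη, hu, add_zero] at hx ⊢; exact hx) hvp
    rw [hcomm.eq]
    simpa using this
  have hwm : ¬ Cn S {g | η g ≤ c} 1 (u * τ u) := fun h => hvm (h.trans (hvw.symm hS))
  have d1 : D c 1 = 1 := if_pos ⟨Cn.refl _, Cn.refl _⟩
  have du : D c u = 0 := if_neg (fun h => hup h.2)
  have dv : D c (τ u) = 0 := if_neg (fun h => hvm h.1)
  have dw : D c (u * τ u) = 0 := if_neg (fun h => hwm h.1)
  have e1 := cm _ _ hum
  have e2 := cm _ _ hvw
  have e3 := cp _ _ hvp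
  have e4 := cp _ _ huw
  rw [d1, dv] at e3
  rw [du, dw] at e4
  rw [e1, e2] at e3
  have : (1 : ZMod 2) = 0 := by linear_combination e3 - e4
  exact absurd this (by decide)

theorem cone_conn_abs {Γ : Type*} [Group Γ] (S : Set Γ) (hSf : S.Finite) (hS : ∀ s ∈ S, s⁻¹ ∈ S)
    (f : FreeGroup S →* Γ) (hSc : Subgroup.closure S = ⊤)
    (hfS : ∀ s : S, f (FreeGroup.of s) = s)
    (hf : Function.Surjective f) (R : Set (FreeGroup S)) (hR : R.Finite)
    (hRk : Subgroup.normalClosure R = f.ker) (η : Γ → ℝ) (hη : ∀ a b, η (a * b) = η a + η b)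
    (τ : Γ →* Γ) (hττ : ∀ g, τ (τ g) = g) (hτS : ∀ s ∈ S, τ s ∈ S) (hητ : ∀ g, η (τ g) = - η g)
    (K : Subgroup Γ) (hKn : K.Normal) (hK0 : ∀ u ∈ K, η u = 0) (hKτ : ∀ u ∈ K, Commute u (τ u))
    (T : Set Γ) (hT : Subgroup.normalClosure T = K) (hTS : T ⊆ S) :
    ∃ c : ℝ, ∀ u ∈ K, Cn S {g | η g ≤ c} 1 u := by
  obtain ⟨c0, hc0, hc⟩ := crux S hS f hfS hf R hR hRk η hη τ hττ hτS hητ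
  obtain ⟨c1, hc1⟩ : ∃ c1, ∀ s ∈ S, |η s| ≤ c1 := by
    obtain ⟨c1, hc1⟩ := (hSf.image (fun s => |η s|)).bddAbove
    exact ⟨c1, fun r hr => hc1 ⟨r, hr, rfl⟩⟩
  let c := max c0 c1
  have hcc := hc c (le_max_left _ _)
  have hcS : ∀ s ∈ S, |η s| ≤ c := fun s hs => (hc1 s hs).trans (le_max_right _ _)
  have hcpos : 0 ≤ c := hc0.trans (le_max_left _ _)
  have hη1 : η 1 = 0 := by have := hη 1 1; simp at this; exact this
  have hηinv : ∀ a, η a⁻¹ = - η a := by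
    intro a
    have := hη a a⁻¹
    rw [mul_inv_cancel, hη1] at this
    linarith
  refine ⟨c, ?_⟩
  have hττ0 : ∀ u ∈ K, Cn S {g | -c ≤ η g} 1 u → Cn S {g | η g ≤ c} 1 u := by
    intro u hu h
    have flip2 : ∀ a b, Cn S {g | -c ≤ η g} a b → Cn S {g | η g ≤ c} (τ a) (τ b) := by
      intro a b h
      have := Cn.map (S' := S) (U' := {g | η g ≤ c}) τ 1 hτS (fun x hx => by
        simp only [Set.mem_setOf_eq, mul_one, hητ] at hx ⊢; linarith) h
      simpa using this
    have h1 := flip2 _ _ h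
    rw [map_one] at h1
    have h2 := hcc (τ u) (by rw [hητ, hK0 u hu, neg_zero])
      (by rw [hττ]; exact (hKτ u hu).symm) h1
    have h3 := flip2 _ _ h2
    rwa [map_one, hττ] at h3
  let A : Subgroup Γ :=
    { carrier := {u | u ∈ K ∧ Cn S {g | η g ≤ c} 1 u}
      one_mem' := ⟨K.one_mem, Cn.refl _⟩
      mul_mem' := by
        rintro u v ⟨hu, hu'⟩ ⟨hv, hv'⟩
        refine ⟨K.mul_mem hu hv, hv'.trans ?_⟩
        have := Cn.right (U' := {g | η g ≤ c}) v (fun x hx => by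
          simp only [Set.mem_setOf_eq, hη, hK0 v hv, add_zero] at hx ⊢; exact hx) hu'
        simpa using this
      inv_mem' := by
        rintro u ⟨hu, hu'⟩
        refine ⟨K.inv_mem hu, ?_⟩
        have := Cn.right (U' := {g | η g ≤ c}) u⁻¹ (fun x hx => by
          simp only [Set.mem_setOf_eq, hη, hηinv, hK0 u hu, neg_zero, add_zero] at hx ⊢; exact hx) hu'
        rw [mul_inv_cancel, one_mul] at this
        exact this.symm hS }
  have hAmem : ∀ u, u ∈ A ↔ u ∈ K ∧ Cn S {g | η g ≤ c} 1 u := fun u => Iff.rfl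
  have hAS : ∀ s ∈ S, ∀ u ∈ A, s * u * s⁻¹ ∈ A := by
    intro s hs u hu
    have hsu : s * u * s⁻¹ ∈ K := hKn.conj_mem u hu.1 s
    refine ⟨hsu, ?_⟩
    have hb := abs_le.1 (hcS s hs)
    rcases le_total 0 (η s) with h0 | h0
    · have e1 : Cn S {g | η g ≤ c} 1 (s⁻¹ * 1) := Cn.step (hS s hs) (by simpa [hη1] using hcpos) (by
        simp only [mul_one, Set.mem_setOf_eq, hηinv]; linarith)
      have e2 := Cn.right (U' := {g | η g ≤ c}) s⁻¹ (fun x hx => by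
        simp only [Set.mem_setOf_eq, hη, hηinv] at hx ⊢; linarith) hu.2
      have e3 : Cn S {g | η g ≤ c} (u * s⁻¹) (s * (u * s⁻¹)) := Cn.step hs (by
        simp only [Set.mem_setOf_eq, hη, hηinv, hK0 u hu.1]; linarith) (by
        simp only [Set.mem_setOf_eq, hη, hηinv, hK0 u hu.1]; linarith)
      rw [mul_one] at e1
      rw [one_mul] at e2
      rw [mul_assoc]
      exact e1.trans (e2.trans e3)
    · apply hττ0 _ hsu
      have hu2 := hcc u (hK0 u hu.1) (hKτ u hu.1) hu.2
      have e1 : Cn S {g | -c ≤ η g} 1 (s⁻¹ * 1) := Cn.step (hS s hs) (by simpa [hη1] using hcpos) (by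
        simp only [mul_one, Set.mem_setOf_eq, hηinv]; linarith)
      have e2 := Cn.right (U' := {g | -c ≤ η g}) s⁻¹ (fun x hx => by
        simp only [Set.mem_setOf_eq, hη, hηinv] at hx ⊢; linarith) hu2
      have e3 : Cn S {g | -c ≤ η g} (u * s⁻¹) (s * (u * s⁻¹)) := Cn.step hs (by
        simp only [Set.mem_setOf_eq, hη, hηinv, hK0 u hu.1]; linarith) (by
        simp only [Set.mem_setOf_eq, hη, hηinv, hK0 u hu.1]; linarith)
      rw [mul_one] at e1
      rw [one_mul] at e2
      rw [mul_assoc]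
      exact e1.trans (e2.trans e3)
  have hAn : A.Normal := by
    refine ⟨fun w hw g => ?_⟩
    have hg : g ∈ Subgroup.closure S := hSc ▸ Subgroup.mem_top g
    induction hg using Subgroup.closure_induction'' generalizing w with
    | mem x hx => exact hAS x hx w hw
    | inv_mem x hx => exact hAS _ (hS x hx) w hw
    | one => simpa using hw
    | mul x y _ _ hx hy =>
      have := hx _ (hy w hw)
      simpa [mul_assoc] using this
  have hKA : K ≤ A := by
    rw [← hT]
    apply Subgroup.normalClosure_le_normal
    intro t ht
    have htK : t ∈ K := hT ▸ Subgroup.subset_normalClosure ht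
    refine ⟨htK, ?_⟩
    have := Cn.step (U := {g | η g ≤ c}) (a := 1) (hTS ht) (by simpa [hη1] using hcpos)
      (by simp only [mul_one, Set.mem_setOf_eq, hK0 t htK]; exact hcpos)
    rwa [mul_one] at this
  exact fun u hu => (hKA hu).2

theorem cone_conn {G : Type*} [Group G] [hG : Group.IsFinitelyPresented G] (N : Subgroup G)
    [hNn : N.Normal] (H : Subgroup (G × G)) (hH : ∀ p : G × G, p ∈ H ↔ p.1 * p.2 ∈ N)
    [hHfp : Group.IsFinitelyPresented H] :
    ∃ S : Set G, S.Finite ∧ (∀ s ∈ S, s⁻¹ ∈ S) ∧ ∀ χ : G → ℝ, (∀ a b, χ (a * b) = χ a + χ b) →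
      (∀ a ∈ N, χ a = 0) → ∃ c : ℝ, ∀ a ∈ N, Cn S {g | χ g ≤ c} 1 a := by
  have hHfg : Group.FG H := fp_fg
  have hsw : ∀ p ∈ H, p.swap ∈ H := by
    intro p hp
    rw [hH] at hp ⊢
    exact hNn.mem_comm hp
  let τ : H →* H :=
    { toFun := fun p => ⟨p.1.swap, hsw _ p.2⟩
      map_one' := rfl
      map_mul' := fun a b => rfl }
  have hττ : ∀ p, τ (τ p) = p := fun p => rfl
  let p2 : H →* G := (MonoidHom.snd G G).comp H.subtype
  have hp2 : Function.Surjective p2 := fun g => ⟨⟨(g⁻¹, g), by rw [hH]; simp⟩, rfl⟩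
  let p1 : H →* G := (MonoidHom.fst G G).comp H.subtype
  obtain ⟨T, hTf, hT⟩ := fp_ker p2 hp2
  obtain ⟨S0, hS0, hS0f⟩ := Group.fg_iff.1 hHfg
  let S1 : Set H := S0 ∪ T
  let S2 : Set H := S1 ∪ (fun x => x⁻¹) '' S1
  let S : Set H := S2 ∪ τ '' S2
  have hS1f : S1.Finite := hS0f.union hTf
  have hS2f : S2.Finite := hS1f.union (hS1f.image _)
  have hSf : S.Finite := hS2f.union (hS2f.image _)
  have hS2i : ∀ s ∈ S2, s⁻¹ ∈ S2 := by
    rintro _ (h | ⟨s, h, rfl⟩)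
    · exact Or.inr ⟨_, h, rfl⟩
    · simp only [inv_inv]; exact Or.inl h
  have hS : ∀ s ∈ S, s⁻¹ ∈ S := by
    rintro _ (h | ⟨s, h, rfl⟩)
    · exact Or.inl (hS2i _ h)
    · rw [← map_inv]; exact Or.inr ⟨_, hS2i _ h, rfl⟩
  have hτS : ∀ s ∈ S, τ s ∈ S := by
    rintro _ (h | ⟨s, h, rfl⟩)
    · exact Or.inr ⟨_, h, rfl⟩
    · rw [hττ]; exact Or.inl h
  have hTS : T ⊆ S := fun t ht => Or.inl (Or.inl (Or.inr ht))
  have hSc : Subgroup.closure S = ⊤ := by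
    rw [eq_top_iff, ← hS0]
    exact Subgroup.closure_mono (fun t ht => Or.inl (Or.inl (Or.inl ht)))
  let f : FreeGroup S →* H := FreeGroup.lift Subtype.val
  have hfs : Function.Surjective f := by
    rw [← MonoidHom.range_eq_top, FreeGroup.range_lift_eq_closure, Subtype.range_coe, hSc]
  have : Finite S := hSf
  obtain ⟨R, hRf, hR⟩ := fp_ker f hfs
  refine ⟨p1 '' S, hSf.image _, ?_, ?_⟩
  · rintro _ ⟨s, hs, rfl⟩
    rw [← map_inv]
    exact ⟨_, hS s hs, rfl⟩
  · intro χ hχ hχN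
    have hχ1 : χ 1 = 0 := hχN 1 N.one_mem
    obtain ⟨c, hc⟩ := cone_conn_abs S hSf hS f hSc (fun s => by simp [f]) hfs R hRf hR
      (fun h => χ h.1.1) (fun a b => hχ _ _) τ hττ hτS (by
        intro h
        change χ h.1.2 = - χ h.1.1
        have := hχN _ ((hH _).1 h.2)
        rw [hχ] at this
        linarith) p2.ker inferInstance (by
        intro h hh
        have h2 : h.1.2 = 1 := hh
        have := (hH _).1 h.2
        rw [h2, mul_one] at this
        exact hχN _ this) (by
        intro h hh
        have h2 : h.1.2 = 1 := hh
        apply Subtype.ext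
        change h.1 * h.1.swap = h.1.swap * h.1
        ext <;> simp [h2]) T hT hTS
    refine ⟨c, fun a ha => ?_⟩
    have := hc ⟨(a, 1), by rw [hH]; simpa using ha⟩ rfl
    have := Cn.map (S' := p1 '' S) (U' := {g | χ g ≤ c}) p1 1 (fun s hs => ⟨s, hs, rfl⟩)
      (fun u hu => by rw [mul_one]; exact hu) this
    simpa [p1] using this

open scoped InnerProductSpace in
theorem disp_eventually {E : Type*} [NormedAddCommGroup E] [InnerProductSpace ℝ E] (v0 d e : E)
    (h : ⟪v0, d⟫_ℝ < 0) :
    ∀ᶠ p in Filter.comap (fun p : E => ‖p‖) Filter.atTop ⊓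
      Filter.comap (fun p : E => ‖p‖⁻¹ • p) (nhds v0), ‖p + e + d‖ < ‖p + e‖ := by
  set l := Filter.comap (fun p : E => ‖p‖) Filter.atTop ⊓
      Filter.comap (fun p : E => ‖p‖⁻¹ • p) (nhds v0) with hl
  have t1 : Filter.Tendsto (fun p : E => ‖p‖) l Filter.atTop :=
    Filter.tendsto_comap.mono_left inf_le_left
  have t2 : Filter.Tendsto (fun p : E => ‖p‖⁻¹ • p) l (nhds v0) :=
    Filter.tendsto_comap.mono_left inf_le_right
  have t3 : Filter.Tendsto (fun p : E => ⟪‖p‖⁻¹ • p, d⟫_ℝ) l (nhds ⟪v0, d⟫_ℝ) :=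
    t2.inner tendsto_const_nhds
  have t4 := t1.atTop_mul_neg h t3
  have e1 := t4.eventually (Filter.eventually_lt_atBot (-(2 * ⟪e, d⟫_ℝ + ‖d‖ ^ 2) / 2))
  have e2 := t1.eventually (Filter.eventually_gt_atTop 0)
  filter_upwards [e1, e2] with p h1 h2
  have h3 : ‖p‖ * ⟪‖p‖⁻¹ • p, d⟫_ℝ = ⟪p, d⟫_ℝ := by
    rw [real_inner_smul_left]; field_simp
  rw [h3] at h1
  have h4 := norm_add_sq_real (p + e) d
  rw [inner_add_left] at h4
  apply lt_of_pow_lt_pow_left₀ 2 (norm_nonneg _)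
  rw [h4]; linarith

theorem Cn.finite {Γ : Type*} [Group Γ] {S U : Set Γ} {a b : Γ} (h : Cn S U a b) :
    ∃ F : Set Γ, F.Finite ∧ F ⊆ U ∧ Cn S F a b := by
  induction h with
  | refl => exact ⟨∅, Set.finite_empty, Set.empty_subset _, Cn.refl _⟩
  | @tail b c _ h ih =>
    obtain ⟨F, hF, hFU, hc⟩ := ih
    obtain ⟨h1, h2, s, hs, rfl⟩ := h
    refine ⟨F ∪ {b, s * b}, hF.union (by simp), ?_, ?_⟩
    · rintro y (hy | rfl | rfl)
      exacts [hFU hy, h1, h2]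
    · exact (hc.mono subset_rfl Set.subset_union_left).trans (Cn.step hs (by simp) (by simp))

/-- A point `p` which can be removed from the region. -/
def GoodPt {G E : Type*} [Group G] [NormedAddCommGroup E] (S : Set G) (θ : G → E) (p : E) : Prop :=
  ∀ T : Set E, (∀ u ∈ T, ‖u‖ ≤ ‖p‖) → (∀ g, ‖θ g‖ < ‖p‖ → θ g ∈ T) → p ∉ T →
    ∀ a b, Cn S {g | θ g ∈ T ∨ θ g = p} a b → θ a ≠ p → θ b ≠ p → Cn S {g | θ g ∈ T} a b

theorem goodPt_of_data {G E : Type*} [Group G] [NormedAddCommGroup E] (S : Set G) (θ : G → E)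
    (hS : ∀ s ∈ S, s⁻¹ ∈ S) (hθ : ∀ a b, θ (a * b) = θ a + θ b) (p : E) (x : G) (hx : x ∈ S) (k : ℕ)
    (hn : ∀ s ∈ S, ∃ F, Cn S F 1 (x ^ k * s * (x ^ k)⁻¹ * s⁻¹) ∧
      ∀ w ∈ F, ‖p + (θ w + θ (x ^ k))‖ < ‖p‖)
    (h0 : ‖p + θ (x ^ k)‖ < ‖p‖)
    (h1 : ∀ s ∈ S, ‖p + (θ (x ^ k) - θ s)‖ < ‖p‖)
    (h2 : ∀ s ∈ S, ∀ j, 1 ≤ j → j ≤ k → ‖p + -θ s + θ (x ^ j)‖ < ‖p + -θ s‖) :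
    GoodPt S θ p := by
  classical
  intro T hT1 hT2 hpT a b hab ha hb
  set V : Set G := {g | θ g ∈ T} with hV
  -- sideways moves
  have L1 : ∀ s ∈ S, ∀ v, θ (s * v) = p → Cn S V (x ^ k * v) (x ^ k * (s * v)) := by
    intro s hs v hv
    have hv' : θ v = p - θ s := by rw [← hv, hθ]; abel
    have c1 : Cn S V (x ^ k * v) (s * (x ^ k * v)) := by
      refine Cn.step hs (hT2 _ ?_) (hT2 _ ?_)
      · rw [hθ, hv']; convert h1 s hs using 2; abel
      · rw [hθ, hθ, hv']; convert h0 using 2; abel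
    obtain ⟨F, hF, hFw⟩ := hn s hs
    have c2 := Cn.right (U' := V) (s * (x ^ k * v)) (fun w hw => by
      refine hT2 _ ?_
      rw [hθ, hθ, hθ, hv']; convert hFw w hw using 2; abel) hF
    refine c1.trans ?_
    convert c2 using 1
    · simp
    · group
  have L2 : ∀ s ∈ S, ∀ v, θ (s * v) = p → θ v ∈ T → Cn S V v (x ^ k * v) := by
    intro s hs v hv hvT
    have hv' : θ v = p + - θ s := by rw [← hv, hθ]; abel
    have key : ∀ j, j ≤ k → θ (x ^ j * v) ∈ T := by
      intro j hj
      rcases Nat.eq_zero_or_pos j with rfl | hj0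
      · simpa using hvT
      · refine hT2 _ ?_
        have := h2 s hs j hj0 hj
        rw [← hv'] at this
        rw [hθ, add_comm]
        exact this.trans_le (hT1 _ hvT)
    have : ∀ j, j ≤ k → Cn S V v (x ^ j * v) := by
      intro j
      induction j with
      | zero => intro _; simpa using Cn.refl v
      | succ j ih =>
        intro hj
        refine (ih (by omega)).trans ?_
        have := Cn.step (U := V) hx (key j (by omega)) (by
          have := key (j + 1) hj
          rwa [pow_succ', mul_assoc] at this)
        rwa [← mul_assoc, ← pow_succ'] at this
    exact this k le_rfl
  let f : G → G := fun v => if θ v = p then x ^ k * v else v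
  have main : ∀ b, Cn S {g | θ g ∈ T ∨ θ g = p} a b → Cn S V (f a) (f b) := by
    intro b hab
    induction hab with
    | refl => exact Cn.refl _
    | @tail v c _ h ih =>
      refine ih.trans ?_
      obtain ⟨h1', h2', s, hs, rfl⟩ := h
      by_cases e1 : θ v = p
      · by_cases e2 : θ (s * v) = p
        · simp only [f, e1, e2, if_true]
          exact L1 s hs v e2
        · simp only [f, e1, e2, if_true, if_false]
          have e3 : θ (s⁻¹ * (s * v)) = p := by simpa using e1
          have hT' : θ (s * v) ∈ T := h2'.resolve_right e2
          have := (L2 _ (hS s hs) _ e3 hT').trans (L1 _ (hS s hs) _ e3)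
          rw [inv_mul_cancel_left] at this
          exact this.symm hS
      · have hT' : θ v ∈ T := h1'.resolve_right e1
        by_cases e2 : θ (s * v) = p
        · simp only [f, e1, e2, if_true, if_false]
          exact (L2 s hs v e2 hT').trans (L1 s hs v e2)
        · simp only [f, e1, e2, if_false]
          exact Cn.step hs hT' (h2'.resolve_right e2)
  have := main b hab
  simpa only [f, ha, hb, if_false] using this

open scoped InnerProductSpace in
theorem goodPt_eventually {G E : Type*} [Group G] [NormedAddCommGroup E] [InnerProductSpace ℝ E]
    (N : Subgroup G) (hc : commutator G ≤ N) (S : Set G) (hSf : S.Finite) (θ : G → E)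
    (hS : ∀ s ∈ S, s⁻¹ ∈ S) (hθ : ∀ a b, θ (a * b) = θ a + θ b)
    (v0 : E) (c : ℝ) (hcn : ∀ a ∈ N, Cn S {g | ⟪v0, θ g⟫_ℝ ≤ c} 1 a)
    (x : G) (hx : x ∈ S) (hxv : ⟪v0, θ x⟫_ℝ < 0) :
    ∀ᶠ p in Filter.comap (fun p : E => ‖p‖) Filter.atTop ⊓
      Filter.comap (fun p : E => ‖p‖⁻¹ • p) (nhds v0), GoodPt S θ p := by
  have h1 : θ 1 = 0 := by simpa using hθ 1 1
  have hpow : ∀ j : ℕ, θ (x ^ j) = (j : ℝ) • θ x := by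
    intro j
    induction j with
    | zero => simp [h1]
    | succ j ih => rw [pow_succ, hθ, ih]; push_cast; rw [add_smul, one_smul]
  have hin : ∀ j : ℕ, ⟪v0, θ (x ^ j)⟫_ℝ = j * ⟪v0, θ x⟫_ℝ := by
    intro j; rw [hpow, real_inner_smul_right]
  -- choose a bound
  obtain ⟨B, hB⟩ : ∃ B : ℝ, ∀ s ∈ S, -⟪v0, θ s⟫_ℝ ≤ B := by
    obtain ⟨B, hB⟩ := (hSf.image (fun s => -⟪v0, θ s⟫_ℝ)).bddAbove
    exact ⟨B, fun s hs => hB ⟨s, hs, rfl⟩⟩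
  obtain ⟨k, hk⟩ := exists_nat_gt ((max 1 (max B c)) / (-⟪v0, θ x⟫_ℝ))
  rw [div_lt_iff₀ (by linarith)] at hk
  have hkB : B + k * ⟪v0, θ x⟫_ℝ < 0 := by
    have := le_max_left B c; have := le_max_right 1 (max B c); linarith
  have hkc : c + k * ⟪v0, θ x⟫_ℝ < 0 := by
    have := le_max_right B c; have := le_max_right 1 (max B c); linarith
  have hk0 : k * ⟪v0, θ x⟫_ℝ < 0 := by
    have := le_max_left 1 (max B c); linarith
  have hpath : ∀ s : G, ∃ F : Set G, F.Finite ∧ F ⊆ {g | ⟪v0, θ g⟫_ℝ ≤ c} ∧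
      Cn S F 1 (x ^ k * s * (x ^ k)⁻¹ * s⁻¹) := by
    intro s
    refine (hcn _ (hc ?_)).finite
    have := Subgroup.commutator_mem_commutator (Subgroup.mem_top (x ^ k)) (Subgroup.mem_top s)
    exact this
  choose F hFf hFU hFc using hpath
  have A : ∀ᶠ p in Filter.comap (fun p : E => ‖p‖) Filter.atTop ⊓
      Filter.comap (fun p : E => ‖p‖⁻¹ • p) (nhds v0), ∀ s ∈ S, ∀ w ∈ F s,
      ‖p + (θ w + θ (x ^ k))‖ < ‖p‖ := by
    rw [Filter.eventually_all_finite hSf]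
    intro s hs
    rw [Filter.eventually_all_finite (hFf s)]
    intro w hw
    have := disp_eventually v0 (θ w + θ (x ^ k)) 0 (by
      rw [inner_add_right, hin]
      have : ⟪v0, θ w⟫_ℝ ≤ c := hFU s hw
      linarith)
    simpa using this
  have B0 : ∀ᶠ p in Filter.comap (fun p : E => ‖p‖) Filter.atTop ⊓
      Filter.comap (fun p : E => ‖p‖⁻¹ • p) (nhds v0), ‖p + θ (x ^ k)‖ < ‖p‖ := by
    have := disp_eventually v0 (θ (x ^ k)) 0 (by rw [hin]; exact hk0)
    simpa using this
  have B1 : ∀ᶠ p in Filter.comap (fun p : E => ‖p‖) Filter.atTop ⊓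
      Filter.comap (fun p : E => ‖p‖⁻¹ • p) (nhds v0), ∀ s ∈ S,
      ‖p + (θ (x ^ k) - θ s)‖ < ‖p‖ := by
    rw [Filter.eventually_all_finite hSf]
    intro s hs
    have := disp_eventually v0 (θ (x ^ k) - θ s) 0 (by
      rw [inner_sub_right, hin]; have := hB s hs; linarith)
    simpa using this
  have B2 : ∀ᶠ p in Filter.comap (fun p : E => ‖p‖) Filter.atTop ⊓
      Filter.comap (fun p : E => ‖p‖⁻¹ • p) (nhds v0), ∀ s ∈ S, ∀ j ∈ Set.Icc 1 k,
      ‖p + -θ s + θ (x ^ j)‖ < ‖p + -θ s‖ := by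
    rw [Filter.eventually_all_finite hSf]
    intro s hs
    rw [Filter.eventually_all_finite (Set.finite_Icc 1 k)]
    intro j hj
    refine disp_eventually v0 _ _ ?_
    rw [hin]
    have : (1 : ℝ) ≤ j := by exact_mod_cast hj.1
    nlinarith
  filter_upwards [A, B0, B1, B2] with p a b0 b1 b2
  exact goodPt_of_data S θ hS hθ p x hx k (fun s hs => ⟨F s, hFc s, a s hs⟩) b0 b1
    (fun s hs j h h' => b2 s hs j ⟨h, h'⟩)

theorem goodPt_far {G E : Type*} [Group G] [NormedAddCommGroup E] [NormedSpace ℝ E] [ProperSpace E]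
    (S : Set G) (θ : G → E)
    (h : ∀ v0 : E, ‖v0‖ = 1 → ∀ᶠ p in Filter.comap (fun p : E => ‖p‖) Filter.atTop ⊓
      Filter.comap (fun p : E => ‖p‖⁻¹ • p) (nhds v0), GoodPt S θ p) :
    ∃ m : ℝ, ∀ p : E, m < ‖p‖ → GoodPt S θ p := by
  have key : ∀ᶠ p in Filter.comap (fun p : E => ‖p‖) Filter.atTop,
      ‖p‖⁻¹ • p ∈ Metric.sphere (0 : E) 1 → GoodPt S θ p := by
    refine (isCompact_sphere (0 : E) 1).induction_on
      (p := fun s => ∀ᶠ p in Filter.comap (fun p : E => ‖p‖) Filter.atTop,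
        ‖p‖⁻¹ • p ∈ s → GoodPt S θ p) ?_ ?_ ?_ ?_
    · simp
    · intro s t hst ht
      filter_upwards [ht] with p hp hps using hp (hst hps)
    · intro s t hs ht
      filter_upwards [hs, ht] with p h1 h2 h3
      exact h3.elim h1 h2
    · intro v hv
      have := h v (by simpa using hv)
      rw [Filter.eventually_inf] at this
      obtain ⟨s, hs, t, ht, hst⟩ := this
      obtain ⟨t', ht', htt⟩ := ht
      refine ⟨t', mem_nhdsWithin_of_mem_nhds ht', ?_⟩
      filter_upwards [hs] with p hp hpt
      exact hst p ⟨hp, htt hpt⟩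
  rw [Filter.eventually_comap] at key
  obtain ⟨m, hm⟩ := Filter.eventually_atTop.1 key
  refine ⟨max m 0, fun p hp => hm ‖p‖ ((le_max_left _ _).trans hp.le) p rfl ?_⟩
  have : 0 < ‖p‖ := (le_max_right _ _).trans_lt hp
  simp [norm_smul, this.ne']

theorem descend {G E : Type*} [Group G] [NormedAddCommGroup E]
    (S : Set G) (θ : G → E) (m : ℝ) (hm : ∀ p : E, m < ‖p‖ → GoodPt S θ p) (a : G) (h1 : ‖θ 1‖ ≤ m) (ha : ‖θ a‖ ≤ m) :
    ∀ T : Finset E, (∀ p ∈ T, p ∈ Set.range θ) →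
      (∀ p ∈ T, ∀ g, ‖θ g‖ < ‖p‖ → θ g ∈ T) → Cn S {g | θ g ∈ T} 1 a →
      Cn S {g | ‖θ g‖ ≤ m} 1 a := by
  classical
  intro T
  induction T using Finset.strongInduction with
  | H T ih =>
    intro hr hd hcn
    by_cases hT : ∀ p ∈ T, ‖p‖ ≤ m
    · exact hcn.mono subset_rfl (fun g hg => (hT (θ g) hg : ‖θ g‖ ≤ m))
    push Not at hT
    obtain ⟨p1, hp1, hp1m⟩ := hT
    obtain ⟨p, hp, hmax⟩ := T.exists_max_image (fun p => ‖p‖) ⟨p1, hp1⟩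
    have hpm : m < ‖p‖ := hp1m.trans_le (hmax p1 hp1)
    have hlt : ∀ g, ‖θ g‖ < ‖p‖ → θ g ≠ p := fun g hg h => by rw [h] at hg; exact lt_irrefl _ hg
    refine ih (T.erase p) (Finset.erase_ssubset hp) (fun q hq => hr q (Finset.mem_of_mem_erase hq))
      ?_ ?_
    · intro q hq g hg
      have hq' := Finset.mem_of_mem_erase hq
      exact Finset.mem_erase.2 ⟨hlt g (hg.trans_le (hmax q hq')), hd q hq' g hg⟩
    · have := hm p hpm (T.erase p : Finset E) (fun u hu => hmax u (Finset.mem_of_mem_erase hu))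
        (fun g hg => Finset.mem_coe.2 (Finset.mem_erase.2 ⟨hlt g hg, hd p hp g hg⟩)) (by simp) 1 a
        (hcn.mono subset_rfl ?_) (hlt _ (h1.trans_lt hpm)) (hlt _ (ha.trans_lt hpm))
      · simpa only [Finset.mem_coe] using this
      · intro g hg
        by_cases e : θ g = p
        · exact Or.inr e
        · exact Or.inl (Finset.mem_coe.2 (Finset.mem_erase.2 ⟨e, hg⟩))

theorem fg_of_conn {G Q : Type*} [Group G] [Group Q] (q : G →* Q) (N : Subgroup G)
    (hq : ∀ g, g ∈ N ↔ q g = 1) (S U : Set G) (hS : S.Finite) (hU : (q '' U).Finite)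
    (hqs : Function.Surjective q)
    (h : ∀ a ∈ N, Cn S U 1 a) : N.FG := by
  choose e he using hqs
  set X : Set G := (fun y : G × Q => (e (q y.1 * y.2))⁻¹ * y.1 * e y.2) '' (S ×ˢ (q '' U)) ∪ {e 1}
    with hX
  have hXf : X.Finite := ((hS.prod hU).image _).union (Set.finite_singleton _)
  have hW : Subgroup.closure X = N := by
    apply le_antisymm
    · rw [Subgroup.closure_le]
      rintro y (⟨⟨s, t⟩, _, rfl⟩ | rfl)
      · rw [SetLike.mem_coe, hq]; simp [he]
      · rw [SetLike.mem_coe, hq, he]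
    · intro a ha
      have key : ∀ u, Cn S U 1 u → (e (q u))⁻¹ * u ∈ Subgroup.closure X := by
        intro u hu
        induction hu with
        | refl =>
          rw [map_one, mul_one]
          exact inv_mem (Subgroup.subset_closure (Or.inr rfl))
        | @tail v c _ hst ih =>
          obtain ⟨h1, h2, s, hs, rfl⟩ := hst
          have : (e (q s * q v))⁻¹ * s * e (q v) ∈ Subgroup.closure X :=
            Subgroup.subset_closure (Or.inl ⟨(s, q v), ⟨hs, ⟨v, h1, rfl⟩⟩, rfl⟩)
          have := mul_mem this ih
          rw [map_mul]
          convert this using 1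
          group
      have k1 := key a (h a ha)
      rw [(hq a).1 ha] at k1
      have := mul_mem (Subgroup.subset_closure (show e 1 ∈ X from Or.inr rfl)) k1
      simpa using this
  rw [Subgroup.fg_iff]
  exact ⟨X, hW, hXf⟩

open scoped InnerProductSpace in
theorem exists_theta {Q : Type*} [CommGroup Q] [Group.FG Q] :
    ∃ (j : Type) (_ : Fintype j) (θ : Q → EuclideanSpace ℝ j) (X : Set Q),
      (∀ a b, θ (a * b) = θ a + θ b) ∧ (∀ r : ℝ, {a | ‖θ a‖ ≤ r}.Finite) ∧ X.Finite ∧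
      (∀ v, v ≠ 0 → ∃ x ∈ X, ⟪v, θ x⟫_ℝ < 0) := by
  classical
  obtain ⟨ι, j, hι, hj, p, hp, e, ⟨φ⟩⟩ := CommGroup.equiv_free_prod_prod_multiplicative_zmod Q
  have : ∀ i, NeZero (p i ^ e i) := fun i => ⟨pow_ne_zero _ (hp i).ne_zero⟩
  let θ : Q → EuclideanSpace ℝ j := fun a => WithLp.toLp 2 (fun i => ((φ a).1 i).toAdd)
  have hθ : ∀ a b, θ (a * b) = θ a + θ b := by
    intro a b; ext i; simp [θ]
  let x : j → ℤ → Q := fun i z => φ.symm (Pi.mulSingle i (Multiplicative.ofAdd z), 1)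
  have hx : ∀ i z, θ (x i z) = EuclideanSpace.single i (z : ℝ) := by
    intro i z; ext i'
    by_cases h : i' = i
    · subst h; simp [θ, x]
    · simp [θ, x, h]
  refine ⟨j, hj, θ, Set.range (fun i => x i 1) ∪ Set.range (fun i => x i (-1)), hθ, ?_,
    (Set.finite_range _).union (Set.finite_range _), ?_⟩
  · intro r
    have f1 : (Set.univ.pi (fun _ : j => (Multiplicative.toAdd ⁻¹' {z : ℤ | |(z : ℝ)| ≤ r} :
        Set (Multiplicative ℤ)))).Finite := by
      refine Set.Finite.pi fun i => ?_
      refine Set.Finite.preimage Multiplicative.toAdd.injective.injOn ?_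
      refine (Set.finite_Icc (-⌈r⌉) ⌈r⌉).subset ?_
      intro z hz
      have hz : |(z : ℝ)| ≤ r := hz
      have h1 := abs_le.1 (hz.trans (Int.le_ceil r))
      exact ⟨by exact_mod_cast h1.1, by exact_mod_cast h1.2⟩
    have f2 := f1.prod (Set.finite_univ (α := (i : ι) → Multiplicative (ZMod (p i ^ e i))))
    refine (f2.preimage φ.injective.injOn).subset ?_
    intro a ha
    refine ⟨fun i _ => ?_, Set.mem_univ _⟩
    have : ‖θ a i‖ ≤ ‖θ a‖ := PiLp.norm_apply_le _ _
    exact this.trans ha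
  · intro v hv
    obtain ⟨i, hi⟩ : ∃ i, v i ≠ 0 := by
      by_contra! h
      exact hv (by ext i; simpa using h i)
    rcases lt_or_gt_of_ne hi with h | h
    · refine ⟨x i 1, Or.inl ⟨i, rfl⟩, ?_⟩
      rw [hx, EuclideanSpace.inner_single_right]; simpa using h
    · refine ⟨x i (-1), Or.inr ⟨i, rfl⟩, ?_⟩
      rw [hx, EuclideanSpace.inner_single_right]; simpa using h

open scoped InnerProductSpace in
theorem forward {G : Type*} [Group G] [Group.IsFinitelyPresented G] (N : Subgroup G) [N.Normal]
    (hc : commutator G ≤ N) (H : Subgroup (G × G)) (hH : ∀ p : G × G, p ∈ H ↔ p.1 * p.2 ∈ N)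
    [Group.IsFinitelyPresented H] : N.FG := by
  classical
  obtain ⟨S0, hS0f, hS0, hcone⟩ := cone_conn N H hH
  obtain ⟨Q, _, q, hqs, hq⟩ := exists_comm_quot N hc
  have : Group.FG G := fp_fg
  have : Group.FG Q := Group.fg_of_surjective hqs
  obtain ⟨j, _, θ', X', hθ', hfin', hX'f, hX'⟩ := exists_theta (Q := Q)
  choose e he using hqs
  set θ : G → EuclideanSpace ℝ j := fun g => θ' (q g) with hθd
  have hθ : ∀ a b, θ (a * b) = θ a + θ b := by intro a b; simp only [θ, map_mul, hθ']
  have h1' : θ' 1 = 0 := by simpa using hθ' 1 1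
  have hN : ∀ a ∈ N, θ a = 0 := by
    intro a ha; simp only [θ, (hq a).1 ha, h1']
  have h1 : θ 1 = 0 := hN 1 (one_mem N)
  set Y : Set G := e '' X' with hY
  have hYf : Y.Finite := hX'f.image _
  set S : Set G := S0 ∪ (Y ∪ Y⁻¹) with hSd
  have hSf : S.Finite := hS0f.union (hYf.union hYf.inv)
  have hS : ∀ s ∈ S, s⁻¹ ∈ S := by
    rintro s (h | h | h)
    · exact Or.inl (hS0 s h)
    · exact Or.inr (Or.inr (by simpa using h))
    · exact Or.inr (Or.inl h)
  obtain ⟨m, hm⟩ := goodPt_far S θ (fun v0 hv0 => by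
    obtain ⟨x, hx, hxv⟩ := hX' v0 (by rintro rfl; simp at hv0)
    obtain ⟨c, hcn⟩ := hcone (fun g => ⟪v0, θ g⟫_ℝ)
      (fun a b => by simp only [hθ, inner_add_right]) (fun a ha => by simp only [hN a ha, inner_zero_right])
    exact goodPt_eventually N hc S hSf θ hS hθ v0 c
      (fun a ha => (hcn a ha).mono Set.subset_union_left subset_rfl) (e x)
      (Or.inr (Or.inl ⟨x, hx, rfl⟩)) (by simpa only [θ, he] using hxv))
  have hfin : ∀ r : ℝ, {p | p ∈ Set.range θ ∧ ‖p‖ ≤ r}.Finite := by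
    intro r
    refine ((hfin' r).image θ').subset ?_
    rintro _ ⟨⟨g, rfl⟩, hg⟩
    exact ⟨q g, hg, rfl⟩
  refine fg_of_conn q N hq S {g | ‖θ g‖ ≤ max m 0} hSf ?_ (fun y => ⟨e y, he y⟩) ?_
  · refine (hfin' (max m 0)).subset ?_
    rintro _ ⟨g, hg, rfl⟩
    exact hg
  · intro a ha
    obtain ⟨c, hcn⟩ := hcone (fun _ => 0) (by simp) (by simp)
    obtain ⟨F, hF, _, hFc⟩ := (hcn a ha).finite
    obtain ⟨R, hR⟩ := (hF.image (fun g => ‖θ g‖)).bddAbove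
    refine descend S θ (max m 0) (fun p hp => hm p ((le_max_left _ _).trans_lt hp)) a
      (by simp [h1]) (by simp [hN a ha]) (hfin R).toFinset ?_ ?_ ?_
    · intro p hp
      exact ((hfin R).mem_toFinset.1 hp).1
    · intro p hp g hg
      exact (hfin R).mem_toFinset.2 ⟨⟨g, rfl⟩, hg.le.trans ((hfin R).mem_toFinset.1 hp).2⟩
    · refine hFc.mono Set.subset_union_left ?_
      intro g hg
      exact (hfin R).mem_toFinset.2 ⟨⟨g, rfl⟩, hR ⟨g, hg, rfl⟩⟩

theorem bridge {G : Type*} [Group G] : FinitelyPresentedGroup G ↔ Group.IsFinitelyPresented G := by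
  constructor
  · rintro ⟨n, f, S, hf, hk⟩
    exact ⟨n, f, hf, ⟨S, S.finite_toSet, hk.symm⟩⟩
  · rintro ⟨n, f, hf, ⟨S, hS, hk⟩⟩
    exact ⟨n, f, hS.toFinset, hf, by rw [hS.coe_toFinset, hk]⟩

/-- For a finitely presented group `G` and `G' ≤ N ⊴ G`, the `N`-fibre product twisted by
the inversion automorphism of `G/N`, i.e. `H = {(g₁,g₂) : g₁g₂ ∈ N} ≤ G × G`, is finitely
presented iff `N` is finitely generated. -/
theorem inversion_twisted_fibre_product_fp_iff {G : Type*} [Group G]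
    (hfp : FinitelyPresentedGroup G)
    (N : Subgroup G) [N.Normal] (hc : commutator G ≤ N)
    (H : Subgroup (G × G)) (hH : ∀ p : G × G, p ∈ H ↔ p.1 * p.2 ∈ N) :
    FinitelyPresentedGroup ↥H ↔ N.FG := by
  have hG := bridge.1 hfp
  rw [bridge]
  constructor
  · intro h
    exact forward N hc H hH
  · intro h
    exact backward N hc h H hH
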